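/- arXiv:2004.12093 — 5 statements merged into one kernel-verified Lean document; each statement's English description precedes it below -/
import Mathlib

section
/- Let m, n be positive integers. Then n · |Y_{m,n}| = Σ_{d | n} (−1)^{m(n+d)} · μ(n/d) · C((m+1)d − 1, md), where μ is the Möbius function and C(a,b) is the binomial coefficient; equivalently |Y_{m,n}| = (1/n) Σ_{d|n} (−1)^{m(n+d)} μ(n/d) C((m+1)d−1, md). -/
/-- The constant `c_{m,n} = (mn-2)(n-1)/2` (natural subtraction and division agree with
the intended integer value for all positive `m, n`). -/
def cmn (m n : ℕ) : ℕ := (m * n - 2) * (n - 1) / 2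

/-- Membership in `C_{m,n}`: tuples `(x₁,…,x_N)` with `x_i ∈ {0,…,n-1}` and
`x₁+⋯+x_N ≡ c_{m,n} (mod n)`. -/
def memC (m n : ℕ) (x : Fin (m * n) → Fin n) : Prop :=
  ((∑ i, (x i : ℕ) : ℕ) : ZMod n) = (cmn m n : ZMod n)

/-- Membership in `Y_{m,n}`: the weakly decreasing tuples in `C_{m,n}`. -/
def memY (m n : ℕ) (x : Fin (m * n) → Fin n) : Prop :=
  memC m n x ∧ Antitone x

open Finset

lemma sum_antitone_eq (N n : ℕ) (ζ : ℂ) :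
    (∑ x : {x : Fin N → Fin n // Antitone x}, ζ ^ (∑ i, (x.1 i : ℕ))) =
      ∑ l ∈ finsuppAntidiag (univ : Finset (Fin n)) N, ∏ j : Fin n, (ζ ^ (j : ℕ)) ^ (l j) := by
  have key : ∀ x : Fin N → Fin n, ∀ j, Multiset.toFinsupp (univ.val.map x) j =
      #{i | x i = j} := by
    intro x j
    rw [Multiset.toFinsupp_apply, Multiset.count_map]
    simp [Finset.card, eq_comm]
  refine sum_bij (fun x _ => Multiset.toFinsupp (univ.val.map x.1)) ?_ ?_ ?_ ?_
  · intro x _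
    rw [mem_finsuppAntidiag]
    refine ⟨?_, subset_univ _⟩
    simp_rw [key]
    rw [← card_eq_sum_card_fiberwise (fun _ _ => by simp)]
    simp
  · rintro ⟨x, hx⟩ _ ⟨y, hy⟩ _ h
    have h := Multiset.toFinsupp.injective h
    simp only [Fin.univ_val_map] at h
    rw [Multiset.coe_eq_coe] at h
    have := List.Perm.eq_of_sortedGE (List.sortedGE_ofFn_iff.2 hx) (List.sortedGE_ofFn_iff.2 hy) h
    exact Subtype.ext (List.ofFn_injective this)
  · intro l hl
    rw [mem_finsuppAntidiag] at hl
    let s := Finsupp.toMultiset l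
    have hs : (s.sort (· ≥ ·)).length = N := by
      rw [Multiset.length_sort, Finsupp.card_toMultiset, Finsupp.sum_fintype _ _ (by simp)]
      simpa using hl.1
    have hsort : (s.sort (· ≥ ·)).SortedGE := (Multiset.pairwise_sort s (· ≥ ·)).sortedGE
    refine ⟨⟨fun i => (s.sort (· ≥ ·)).get (i.cast hs.symm), ?_⟩, mem_univ _, ?_⟩
    · exact fun a b hab => hsort.antitone_get (by simpa using hab)
    · refine Eq.trans ?_ (Finsupp.toMultiset_toFinsupp l)
      congr 1
      rw [Fin.univ_val_map]
      have : List.ofFn (fun i : Fin N => (s.sort (· ≥ ·)).get (i.cast hs.symm)) =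
          s.sort (· ≥ ·) := by
        apply List.ext_get
        · simp [hs]
        · intros; simp
      rw [this, Multiset.sort_eq]
  · intro x _
    simp_rw [key, ← pow_mul]
    rw [prod_pow_eq_pow_sum]
    congr 1
    rw [← sum_fiberwise univ x.1]
    refine sum_congr rfl fun j _ => ?_
    rw [sum_congr rfl (g := fun _ => (j : ℕ))]
    · simp [mul_comm]
    · intro i hi; simp at hi; rw [hi]

lemma prod_one_sub (e : ℕ) (he : 0 < e) (ζ : ℂ) (h : IsPrimitiveRoot ζ e) :
    ∏ j ∈ range e, (1 - PowerSeries.C (ζ ^ j) * PowerSeries.X : PowerSeries ℂ) =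
      1 - PowerSeries.X ^ e := by
  have h' : IsPrimitiveRoot (PowerSeries.C ζ) e := h.map_of_injective PowerSeries.C_injective
  have := h'.pow_sub_pow_eq_prod_sub_mul 1 (PowerSeries.X) he
  rw [one_pow] at this
  rw [this]
  symm
  refine (prod_bij (fun j _ => PowerSeries.C ζ ^ j) ?_ ?_ ?_ ?_).symm
  · intro j _
    rw [Polynomial.mem_nthRootsFinset he, ← pow_mul, mul_comm, pow_mul, h'.pow_eq_one, one_pow]
  · intro i hi j hj hij
    exact h'.pow_inj (by simpa using hi) (by simpa using hj) hij
  · intro b hb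
    rw [Polynomial.mem_nthRootsFinset he] at hb
    have : NeZero e := ⟨he.ne'⟩
    obtain ⟨i, hi, h⟩ := h'.eq_pow_of_pow_eq_one hb
    exact ⟨i, by simpa using hi, h⟩
  · intro j _; simp

lemma prod_one_sub' (e d : ℕ) (he : 0 < e) (ζ : ℂ) (h : IsPrimitiveRoot ζ e) :
    ∏ j ∈ range (e * d), (1 - PowerSeries.C (ζ ^ j) * PowerSeries.X : PowerSeries ℂ) =
      (1 - PowerSeries.X ^ e) ^ d := by
  induction d with
  | zero => simp
  | succ d ih =>
    rw [mul_add, mul_one, prod_range_add, ih, pow_succ, ← prod_one_sub e he ζ h]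
    simp [pow_add, pow_mul, h.pow_eq_one]

lemma gen_eval (m e d : ℕ) (he : 0 < e) (hd : 0 < d) (ζ : ℂ) (h : IsPrimitiveRoot ζ e) :
    (∑ x : {x : Fin (m * (e * d)) → Fin (e * d) // Antitone x}, ζ ^ (∑ i, (x.1 i : ℕ))) =
      (((m + 1) * d - 1).choose (m * d) : ℂ) := by
  rw [sum_antitone_eq]
  have h1 : (∏ j : Fin (e * d), (PowerSeries.mk fun k => (ζ ^ (j : ℕ)) ^ k)) *
      (1 - PowerSeries.X ^ e : PowerSeries ℂ) ^ d = 1 := by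
    rw [← prod_one_sub' e d he ζ h, ← Fin.prod_univ_eq_prod_range
      (fun j => (1 - PowerSeries.C (ζ ^ j) * PowerSeries.X : PowerSeries ℂ)), ← prod_mul_distrib]
    refine prod_eq_one fun j _ => ?_
    ext k
    rw [mul_sub, mul_one, mul_left_comm, map_sub, PowerSeries.coeff_C_mul]
    cases k with
    | zero => simp
    | succ k => 
      rw [PowerSeries.coeff_succ_mul_X]
      simp [PowerSeries.coeff_one, pow_succ, mul_comm]
  obtain ⟨d, rfl⟩ : ∃ k, d = k + 1 := ⟨d - 1, by omega⟩
  have h2 := congrArg (PowerSeries.expand e he.ne')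
    (PowerSeries.mk_add_choose_mul_one_sub_pow_eq_one ℂ d)
  simp only [map_mul, map_pow, map_sub, map_one, PowerSeries.expand_X] at h2
  have h3 := (mul_comm _ _).trans h1
  have h4 := left_inv_eq_right_inv h2 h3
  have h5 := congrArg (PowerSeries.coeff (m * (e * (d + 1)))) h4
  rw [PowerSeries.coeff_prod] at h5
  simp only [PowerSeries.coeff_mk] at h5
  rw [← h5, show m * (e * (d + 1)) = e * (m * (d + 1)) by ring, PowerSeries.coeff_expand_mul]
  rw [PowerSeries.coeff_mk]
  norm_cast
  rw [show (m + 1) * (d + 1) - 1 = d + m * (d + 1) by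
    rw [Nat.sub_eq_iff_eq_add (by nlinarith)]; ring]
  rw [Nat.choose_symm_add]


lemma sum_nthRoots_pow (n : ℕ) (hn : 0 < n) (a : ℕ) :
    ∑ ζ ∈ Polynomial.nthRootsFinset n (1 : ℂ), ζ ^ a = if n ∣ a then (n : ℂ) else 0 := by
  have h := Complex.isPrimitiveRoot_exp n hn.ne'
  set ω := Complex.exp (2 * Real.pi * Complex.I / n) with hω
  have h1 : ∑ ζ ∈ Polynomial.nthRootsFinset n (1 : ℂ), ζ ^ a = ∑ j ∈ range n, (ω ^ a) ^ j := by
    symm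
    refine sum_bij (fun j _ => ω ^ j) ?_ ?_ ?_ ?_
    · intro j _
      rw [Polynomial.mem_nthRootsFinset hn, ← pow_mul, mul_comm, pow_mul, h.pow_eq_one, one_pow]
    · intro i hi j hj hij
      exact h.pow_inj (by simpa using hi) (by simpa using hj) hij
    · intro b hb
      rw [Polynomial.mem_nthRootsFinset hn] at hb
      have : NeZero n := ⟨hn.ne'⟩
      obtain ⟨i, hi, h⟩ := h.eq_pow_of_pow_eq_one hb
      exact ⟨i, by simpa using hi, h⟩
    · intro j _; rw [← pow_mul, ← pow_mul, mul_comm]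
  rw [h1]
  split_ifs with hd
  · rw [(h.pow_eq_one_iff_dvd a).2 hd]; simp
  · have hne : ω ^ a ≠ 1 := fun hh => hd ((h.pow_eq_one_iff_dvd a).1 hh)
    rw [geom_sum_eq hne, ← pow_mul, mul_comm, pow_mul, h.pow_eq_one]; simp

lemma sum_nthRoots_split (n : ℕ) (f : ℂ → ℂ) :
    ∑ ζ ∈ Polynomial.nthRootsFinset n (1 : ℂ), f ζ =
      ∑ e ∈ n.divisors, ∑ ζ ∈ primitiveRoots e ℂ, f ζ := by
  classical
  rw [IsPrimitiveRoot.nthRoots_one_eq_biUnion_primitiveRoots, sum_biUnion]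
  intro i _ j _ hij
  exact IsPrimitiveRoot.disjoint hij

lemma sum_primitiveRoots_eq (e : ℕ) (he : 0 < e) :
    ∑ ζ ∈ primitiveRoots e ℂ, ζ = (ArithmeticFunction.moebius e : ℂ) := by
  have key : ∀ n > 0, ∑ i ∈ n.divisors, (∑ ζ ∈ primitiveRoots i ℂ, ζ) =
      if n = 1 then (1:ℂ) else 0 := by
    intro n hn
    have := sum_nthRoots_pow n hn 1
    simp only [pow_one, Nat.dvd_one] at this
    rw [← sum_nthRoots_split, this]
    split_ifs with h
    · simp [h]
    · rfl
  rw [ArithmeticFunction.sum_eq_iff_sum_mul_moebius_eq] at key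
  rw [← key e he, Nat.sum_divisorsAntidiagonal
    (f := fun a b => (ArithmeticFunction.moebius a : ℂ) * if b = 1 then (1:ℂ) else 0)]
  rw [sum_eq_single e]
  · simp [Nat.div_self he]
  · intro b hb hbe
    rw [if_neg, mul_zero]
    intro h
    have := Nat.div_mul_cancel (Nat.dvd_of_mem_divisors hb)
    rw [h] at this; omega
  · simp [he.ne']

lemma cmn_add (m n : ℕ) (hm : 0 < m) (hn : 0 < n) :
    cmn m n + n = m * n.choose 2 + 1 := by
  unfold cmn
  by_cases h : m * n = 1
  · obtain ⟨rfl, rfl⟩ := mul_eq_one.1 h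
    rfl
  have h0 : 0 < m * n := Nat.mul_pos hm hn
  have h2 := Nat.triangle_succ (n - 1)
  rw [Nat.sub_add_cancel hn] at h2
  have h3 : n.choose 2 * 2 = n * (n - 1) := by
    rw [Nat.choose_two_right, Nat.div_mul_cancel]
    exact (Nat.even_mul_pred_self n).two_dvd
  obtain ⟨k, hk⟩ : ∃ k, n = k + 1 := ⟨n - 1, by omega⟩
  obtain ⟨t, ht⟩ : ∃ t, m * n = t + 2 := ⟨m * n - 2, by omega⟩
  have h4 : (m * n - 2) * (n - 1) = 2 * (m * n.choose 2) - 2 * (n - 1) := by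
    rw [show 2 * (m * n.choose 2) = m * (n.choose 2 * 2) by ring, h3, Nat.sub_mul, mul_assoc]
  have h5 : 2 * (n - 1) ≤ 2 * (m * n.choose 2) := by
    rw [show 2 * (m * n.choose 2) = m * (n.choose 2 * 2) by ring, h3, ← mul_assoc]
    exact Nat.mul_le_mul_right _ (by omega)
  rw [h4]
  omega

lemma pow_cmn (m e d : ℕ) (hm : 0 < m) (he : 0 < e) (hd : 0 < d) (ζ : ℂ)
    (h : IsPrimitiveRoot ζ e) :
    ζ ^ cmn m (e * d) = (-1) ^ (m * (e * d + d)) * ζ := by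
  have h1 : ζ ^ (e * d) = 1 := by rw [pow_mul, h.pow_eq_one, one_pow]
  have h2 : ζ ^ cmn m (e * d) = ζ ^ (cmn m (e * d) + e * d) := by rw [pow_add, h1, mul_one]
  rw [h2, cmn_add m _ hm (Nat.mul_pos he hd), pow_succ]
  congr 1
  rw [mul_comm m, mul_comm m, pow_mul, pow_mul]
  congr 1
  have hc : (e * d).choose 2 * 2 = e * d * (e * d - 1) := by
    rw [Nat.choose_two_right, Nat.div_mul_cancel]
    exact (Nat.even_mul_pred_self _).two_dvd
  obtain ⟨p, hp⟩ : ∃ p, e * d = p + 1 := ⟨e * d - 1, by have := Nat.mul_pos he hd; omega⟩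
  have hp' : e * d - 1 = p := by omega
  rw [hp'] at hc
  rcases Nat.even_or_odd' e with ⟨k, hk | hk⟩
  · have hz : ζ ^ k = -1 := by
      have hsq : (ζ ^ k) ^ 2 = 1 := by rw [← pow_mul, mul_comm, ← hk, h.pow_eq_one]
      rcases (mul_self_eq_one_iff.1 ((sq _).symm.trans hsq)) with h' | h'
      · have := Nat.le_of_dvd (by omega) ((h.pow_eq_one_iff_dvd k).1 h')
        omega
      · exact h'
    have hq : (e * d).choose 2 = k * (d * p) := by
      have : (e * d).choose 2 * 2 = (k * (d * p)) * 2 := by rw [hc, hk]; ring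
      omega
    rw [hq, pow_mul, hz]
    have hpo : Odd p := by
      refine ⟨k * d - 1, ?_⟩
      have h1 : 0 < k * d := Nat.mul_pos (by omega) hd
      have : 2 * (k * d) = p + 1 := by rw [← hp, hk]; ring
      omega
    rw [mul_comm d p, pow_mul, hpo.neg_one_pow, pow_add, pow_mul (-1 : ℂ) e,
      (show Even e from ⟨k, by omega⟩).neg_one_pow, one_pow, one_mul]
  · have hR : ((-1 : ℂ)) ^ (e * d + d) = 1 := by
      apply Even.neg_one_pow
      exact ⟨(k + 1) * d, by rw [hk]; ring⟩
    rw [hR, h.pow_eq_one_iff_dvd]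
    have hdv : e ∣ (e * d).choose 2 * 2 := by rw [hc, mul_assoc]; exact dvd_mul_right _ _
    refine Nat.Coprime.dvd_of_dvd_mul_right ?_ hdv
    rw [hk]
    simp

/-- `n·|Y_{m,n}| = ∑_{d ∣ n} (-1)^{m(n+d)} μ(n/d) C((m+1)d - 1, md)` as an identity of
integers; equivalently `|Y_{m,n}|` is `1/n` times the right-hand side. -/
theorem card_Y_formula (m n : ℕ) (hm : 0 < m) (hn : 0 < n) :
    (n : ℤ) * Nat.card {l : Fin (m * n) → Fin n // memY m n l} =
      ∑ d ∈ n.divisors, (-1 : ℤ) ^ (m * (n + d)) *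
        ArithmeticFunction.moebius (n / d) * ((m + 1) * d - 1).choose (m * d) := by
  classical
  have hcond : ∀ x : Fin (m * n) → Fin n,
      memC m n x ↔ n ∣ cmn m n + (n - 1) * ∑ i, (x i : ℕ) := by
    intro x
    unfold memC
    rw [← ZMod.natCast_eq_zero_iff, Nat.cast_add, Nat.cast_mul, Nat.cast_sub hn]
    simp only [CharP.cast_eq_zero, Nat.cast_one, zero_sub, neg_mul, one_mul]
    rw [← sub_eq_add_neg, sub_eq_zero, eq_comm]
  have hcard : (n : ℂ) * Nat.card {l : Fin (m * n) → Fin n // memY m n l} =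
      ∑ x : {x : Fin (m * n) → Fin n // Antitone x},
        if n ∣ cmn m n + (n - 1) * ∑ i, (x.1 i : ℕ) then (n : ℂ) else 0 := by
    rw [← sum_filter, sum_const, nsmul_eq_mul, mul_comm]
    congr 2
    rw [Nat.card_eq_fintype_card, ← Fintype.card_subtype]
    refine Fintype.card_congr
      (((Equiv.subtypeSubtypeEquivSubtypeInter (fun x => Antitone x)
        (fun x : Fin (m * n) → Fin n => n ∣ cmn m n + (n - 1) * ∑ i, (x i : ℕ))).trans
        (Equiv.subtypeEquivRight fun x => ?_)).symm)
    rw [memY, hcond, and_comm]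
  have hmain : (n : ℂ) * Nat.card {l : Fin (m * n) → Fin n // memY m n l} =
      ∑ d ∈ n.divisors, (-1 : ℂ) ^ (m * (n + d)) *
        (ArithmeticFunction.moebius (n / d) : ℂ) * (((m + 1) * d - 1).choose (m * d) : ℂ) := by
    rw [hcard]
    simp_rw [← sum_nthRoots_pow n hn]
    rw [sum_comm, sum_nthRoots_split, ← Nat.sum_div_divisors]
    refine sum_congr rfl fun d hd => ?_
    obtain ⟨e, hne⟩ := (Nat.mem_divisors.1 hd).1
    rw [mul_comm] at hne
    subst hne
    have he0 : 0 < e := Nat.pos_of_mul_pos_right hn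
    have hd0 : 0 < d := Nat.pos_of_mul_pos_left hn
    rw [Nat.mul_div_cancel _ hd0, ← sum_primitiveRoots_eq e he0,
      mul_sum, sum_mul]
    refine sum_congr rfl fun ζ hζ => ?_
    have hζ := isPrimitiveRoot_of_mem_primitiveRoots hζ
    have hinv : ζ ^ (e * d - 1) = ζ⁻¹ := by
      apply eq_inv_of_mul_eq_one_left
      rw [← pow_succ, Nat.sub_add_cancel hn, pow_mul, hζ.pow_eq_one, one_pow]
    simp_rw [pow_add, pow_mul, hinv]
    rw [← mul_sum, gen_eval m e d he0 hd0 _ hζ.inv, pow_cmn m e d hm he0 hd0 ζ hζ, pow_mul (-1 : ℂ) m]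
  exact_mod_cast hmain
end

section
/- Let m, n be positive integers and N = mn. For every x ∈ C_{m,n} there exists exactly one Lyndon word w ∈ B^L_{m,n} such that x = shift^j(σ · λ_w) for some j ∈ {0,…,n−1} and some permutation σ ∈ S_N (where σ acts by permuting coordinates). That is, the tuples λ_w for w ∈ B^L_{m,n} form a complete and irredundant set of representatives for the orbits of the joint action of coordinate permutations and shifts on C_{m,n}. -/
/-- The shift map: add `1` to every coordinate, reducing modulo `n`. -/
def shift {N n : ℕ} (x : Fin N → Fin n) : Fin N → Fin n :=
  fun i => ⟨((x i : ℕ) + 1) % n, Nat.mod_lt _ (x i).pos⟩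

/-- The word `w_λ` associated to a weakly decreasing tuple `λ`: the 0/1 word of length
`(m+1)n` whose letter in (1-indexed) position `j` is `1` exactly when `j = n - λ_i + i`
for some `1 ≤ i ≤ mn`. -/
def wordOf (m n : ℕ) (l : Fin (m * n) → Fin n) : Fin ((m + 1) * n) → Bool :=
  fun j => decide (∃ i : Fin (m * n), (j : ℕ) = n - (l i : ℕ) + (i : ℕ))

/-- The `j`-th cyclic rotation of a word `w` of length `k`. -/
def rot {k : ℕ} (j : ℕ) (w : Fin k → Bool) : Fin k → Bool :=
  fun i => w ⟨((i : ℕ) + j) % k, Nat.mod_lt _ i.pos⟩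

/-- Strict lexicographic order on 0/1 words (with `false < true`). -/
def lexLt {k : ℕ} (v w : Fin k → Bool) : Prop :=
  ∃ i : Fin k, (∀ i' : Fin k, i' < i → v i' = w i') ∧ v i < w i

/-- A word of length `k` is Lyndon if it is strictly lexicographically smaller than all
of its proper cyclic rotations. -/
def isLyndon {k : ℕ} (w : Fin k → Bool) : Prop :=
  ∀ j : ℕ, 1 ≤ j → j ≤ k - 1 → lexLt w (rot j w)

/-- Membership in `B_{m,n}`. -/
def memB (m n : ℕ) (w : Fin ((m + 1) * n) → Bool) : Prop :=
  (Finset.univ.filter fun i => w i = true).card = m * n ∧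
  (Finset.univ.filter fun i => w i = false).card = n ∧
  (∀ i : Fin ((m + 1) * n), (i : ℕ) = 0 → w i = false) ∧
  (((∑ i : Fin ((m + 1) * n), if w i = true then (i : ℕ) + 1 else 0 : ℕ) : ZMod n) = -1)

/-- Number of coordinates with `x i ≥ n - k`. -/
def cnt {N n : ℕ} (x : Fin N → Fin n) (k : ℕ) : ℕ :=
  (Finset.univ.filter fun i => n ≤ (x i : ℕ) + k).card

/-- Position of the `k`-th zero. -/
def zp {N n : ℕ} (x : Fin N → Fin n) (k : ℕ) : ℕ := k + cnt x k

/-- The word attached to an arbitrary tuple. -/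
noncomputable def Wd (m n : ℕ) (x : Fin (m * n) → Fin n) : Fin ((m + 1) * n) → Bool :=
  open Classical in fun j => decide (¬ ∃ k < n, (j : ℕ) = zp x k)

lemma Wd_false {m n : ℕ} (x : Fin (m * n) → Fin n) (j : Fin ((m + 1) * n)) :
    Wd m n x j = false ↔ ∃ k < n, (j : ℕ) = zp x k := by
  classical
  unfold Wd
  rw [decide_eq_false_iff_not, not_not]

lemma cnt_mono {N n : ℕ} (x : Fin N → Fin n) : Monotone (cnt x) := by
  intro a b hab
  apply Finset.card_le_card
  intro i hi
  simp only [Finset.mem_filter, Finset.mem_univ, true_and] at *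
  omega

lemma zp_strictMono {N n : ℕ} (x : Fin N → Fin n) : StrictMono (zp x) := by
  intro a b hab
  have := cnt_mono x hab.le
  unfold zp
  omega

lemma zp_zero {N n : ℕ} (x : Fin N → Fin n) : zp x 0 = 0 := by
  unfold zp cnt
  simp

lemma zp_n {N n : ℕ} (x : Fin N → Fin n) : zp x n = n + N := by
  unfold zp cnt
  simp

lemma cnt_perm {N n : ℕ} (x : Fin N → Fin n) (σ : Equiv.Perm (Fin N)) (k : ℕ) :
    cnt (x ∘ σ) k = cnt x k := by
  unfold cnt
  rw [Finset.card_filter, Finset.card_filter]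
  exact Equiv.sum_comp σ (fun i => if n ≤ (x i : ℕ) + k then 1 else 0)

lemma Wd_perm {m n : ℕ} (x : Fin (m * n) → Fin n) (σ : Equiv.Perm (Fin (m * n))) :
    Wd m n (x ∘ σ) = Wd m n x := by
  unfold Wd zp
  simp only [cnt_perm]

lemma cnt_shift {N n : ℕ} (x : Fin N → Fin n) (k : ℕ) (hk : k < n) :
    cnt (shift x) k + cnt x 1 = cnt x (k + 1) := by
  unfold cnt
  simp only [Finset.card_filter]
  rw [← Finset.sum_add_distrib]
  apply Finset.sum_congr rfl
  intro i _
  have hi := (x i).isLt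
  have hs : ((shift x i : Fin n) : ℕ) = ((x i : ℕ) + 1) % n := rfl
  rcases Nat.lt_or_ge ((x i : ℕ) + 1) n with h | h
  · rw [Nat.mod_eq_of_lt h] at hs
    split_ifs <;> omega
  · have h' : (x i : ℕ) + 1 = n := by omega
    rw [h', Nat.mod_self] at hs
    split_ifs <;> omega

lemma zp_shift {N n : ℕ} (x : Fin N → Fin n) (k : ℕ) (hk : k < n) :
    zp (shift x) k + zp x 1 = zp x (k + 1) := by
  have := cnt_shift x k hk
  unfold zp
  omega

lemma rot_rot {k : ℕ} (a b : ℕ) (w : Fin k → Bool) : rot a (rot b w) = rot (a + b) w := by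
  funext i
  simp only [rot]
  congr 2
  rw [Nat.mod_add_mod, add_assoc]

lemma rot_mod {k : ℕ} (a : ℕ) (w : Fin k → Bool) : rot (a % k) w = rot a w := by
  funext i
  simp only [rot]
  congr 2
  rw [Nat.add_mod_mod]

lemma rot_zero {k : ℕ} (w : Fin k → Bool) : rot 0 w = w := by
  funext i
  simp only [rot]
  congr 1
  apply Fin.ext
  simp [Nat.mod_eq_of_lt i.isLt]

lemma rot_self {k : ℕ} (w : Fin k → Bool) : rot k w = w := by
  rw [← rot_mod, Nat.mod_self, rot_zero]

lemma Wd_shift {m n : ℕ} (hn : 0 < n) (x : Fin (m * n) → Fin n) :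
    Wd m n (shift x) = rot (zp x 1) (Wd m n x) := by
  have hL : (m + 1) * n = zp x n := by rw [zp_n]; ring
  have key : ∀ j : Fin ((m + 1) * n),
      Wd m n (shift x) j = false ↔ rot (zp x 1) (Wd m n x) j = false := by
    intro j
    have hj := j.isLt
    simp only [rot]
    rw [Wd_false, Wd_false]
    simp only
    have sm := zp_strictMono x
    have z0 := zp_zero x
    have z1 : zp x 1 ≤ zp x n := sm.monotone hn
    constructor
    · rintro ⟨k, hk, e⟩
      have := zp_shift x k hk
      rcases Nat.lt_or_ge (k + 1) n with h | h
      · refine ⟨k + 1, h, ?_⟩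
        have := sm h
        rw [Nat.mod_eq_of_lt (by omega)]
        omega
      · have hk' : k + 1 = n := by omega
        refine ⟨0, hn, ?_⟩
        rw [hk'] at this
        rw [e, this, hL, Nat.mod_self, z0]
    · rintro ⟨k, hk, e⟩
      rcases Nat.lt_or_ge ((j : ℕ) + zp x 1) ((m + 1) * n) with h | h
      · rw [Nat.mod_eq_of_lt h] at e
        have h01 := sm (show 0 < 1 by norm_num)
        have hk0 : k ≠ 0 := by
          rintro rfl
          omega
        refine ⟨k - 1, by omega, ?_⟩
        have := zp_shift x (k - 1) (by omega)
        rw [show k - 1 + 1 = k by omega] at this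
        omega
      · rw [Nat.mod_eq_sub_mod h, Nat.mod_eq_of_lt (by omega)] at e
        have hk1 : k < 1 := by
          rw [← sm.lt_iff_lt]
          omega
        have : k = 0 := by omega
        subst this
        refine ⟨n - 1, by omega, ?_⟩
        have := zp_shift x (n - 1) (by omega)
        rw [show n - 1 + 1 = n by omega] at this
        omega
  funext j
  have := key j
  cases h1 : Wd m n (shift x) j <;> cases h2 : rot (zp x 1) (Wd m n x) j <;> simp_all

lemma Wd_shift_iter {m n : ℕ} (hn : 0 < n) (k : ℕ) (hk : k ≤ n) :
    ∀ x : Fin (m * n) → Fin n, Wd m n (shift^[k] x) = rot (zp x k) (Wd m n x) := by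
  induction k with
  | zero => intro x; simp [zp_zero, rot_zero]
  | succ k ih =>
    intro x
    rw [Function.iterate_succ_apply, ih (by omega), Wd_shift hn, rot_rot, zp_shift x k (by omega)]

lemma shift_iter_val {N n : ℕ} (k : ℕ) (x : Fin N → Fin n) (i : Fin N) :
    ((shift^[k] x) i : ℕ) = ((x i : ℕ) + k) % n := by
  induction k with
  | zero => simp [Nat.mod_eq_of_lt (x i).isLt]
  | succ k ih =>
    rw [Function.iterate_succ_apply']
    simp only [shift]
    rw [ih, Nat.mod_add_mod, add_assoc]

lemma lt_cnt_iff {N n : ℕ} (l : Fin N → Fin n) (hl : Antitone l) (k : ℕ) (i : Fin N) :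
    (i : ℕ) < cnt l k ↔ n ≤ (l i : ℕ) + k := by
  constructor
  · intro h
    by_contra hc
    have : cnt l k ≤ (Finset.Iio i).card := by
      apply Finset.card_le_card
      intro a ha
      simp only [Finset.mem_filter, Finset.mem_univ, true_and, Finset.mem_Iio] at *
      by_contra hai
      have := hl (not_lt.mp hai)
      rw [Fin.le_def] at this
      omega
    rw [Fin.card_Iio] at this
    omega
  · intro h
    have : (Finset.Iic i).card ≤ cnt l k := by
      apply Finset.card_le_card
      intro a ha
      simp only [Finset.mem_filter, Finset.mem_univ, true_and, Finset.mem_Iic] at *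
      have := hl ha
      rw [Fin.le_def] at this
      omega
    rw [Fin.card_Iic] at this
    omega

lemma pos_inj {N n : ℕ} (l : Fin N → Fin n) (hl : Antitone l) :
    Function.Injective (fun i : Fin N => n - (l i : ℕ) + (i : ℕ)) := by
  apply StrictMono.injective
  intro a b hab
  have := hl hab.le
  rw [Fin.le_def] at this
  rw [Fin.lt_def] at hab
  simp only
  omega

lemma wordOf_eq_Wd {m n : ℕ} (l : Fin (m * n) → Fin n) (hl : Antitone l) :
    wordOf m n l = Wd m n l := by
  classical
  set P : Finset ℕ := Finset.univ.image (fun i : Fin (m * n) => n - (l i : ℕ) + (i : ℕ)) with hP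
  set Z : Finset ℕ := (Finset.range n).image (zp l) with hZ
  have hPc : P.card = m * n := by
    rw [hP, Finset.card_image_of_injective _ (pos_inj l hl)]; simp
  have hZc : Z.card = n := by
    rw [hZ, Finset.card_image_of_injective _ (zp_strictMono l).injective]; simp
  have hd : Disjoint P Z := by
    rw [Finset.disjoint_left]
    intro a ha hb
    simp only [hP, hZ, Finset.mem_image, Finset.mem_univ, true_and, Finset.mem_range] at ha hb
    obtain ⟨i, rfl⟩ := ha
    obtain ⟨k, hk, e⟩ := hb
    have := lt_cnt_iff l hl k i
    unfold zp at e
    have := (l i).isLt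
    omega
  have hL : (m + 1) * n = m * n + n := by ring
  have hU : P ∪ Z = Finset.range ((m + 1) * n) := by
    apply Finset.eq_of_subset_of_card_le
    · apply Finset.union_subset
      · intro a ha
        simp only [hP, Finset.mem_image, Finset.mem_univ, true_and] at ha
        obtain ⟨i, rfl⟩ := ha
        rw [Finset.mem_range]
        have := i.isLt
        omega
      · intro a ha
        simp only [hZ, Finset.mem_image, Finset.mem_range] at ha
        obtain ⟨k, hk, rfl⟩ := ha
        have := zp_strictMono l hk
        rw [zp_n] at this
        rw [Finset.mem_range]
        omega
    · rw [Finset.card_union_of_disjoint hd, hPc, hZc, Finset.card_range, hL]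
  funext j
  unfold wordOf Wd
  rw [decide_eq_decide]
  have h1 : (∃ i : Fin (m * n), (j : ℕ) = n - (l i : ℕ) + (i : ℕ)) ↔ (j : ℕ) ∈ P := by
    simp [hP, eq_comm]
  have h2 : (∃ k < n, (j : ℕ) = zp l k) ↔ (j : ℕ) ∈ Z := by
    simp [hZ, eq_comm]
  rw [h1, h2]
  have h3 : (j : ℕ) ∈ P ∪ Z := by rw [hU]; simp
  rw [Finset.mem_union] at h3
  have h4 : (j : ℕ) ∈ P → (j : ℕ) ∉ Z := fun h => Finset.disjoint_left.mp hd h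
  tauto

lemma memC_perm {m n : ℕ} (x : Fin (m * n) → Fin n) (hx : memC m n x)
    (σ : Equiv.Perm (Fin (m * n))) : memC m n (x ∘ σ) := by
  unfold memC at *
  rw [← hx]
  congr 1
  exact Equiv.sum_comp σ (fun i => (x i : ℕ))

lemma memC_shift_iter {m n : ℕ} (x : Fin (m * n) → Fin n) (hx : memC m n x) (k : ℕ) :
    memC m n (shift^[k] x) := by
  unfold memC at *
  rw [← hx]
  simp only [shift_iter_val, Nat.cast_sum, ZMod.natCast_mod, Nat.cast_add,
    Finset.sum_add_distrib]
  simp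

lemma two_cmn {m n : ℕ} (hm : 0 < m) (hn : 0 < n) :
    (2 * cmn m n : ℤ) = ((m : ℤ) * n - 2) * (n - 1) := by
  unfold cmn
  rcases Nat.lt_or_ge (m * n) 2 with h | h
  · have h1 : m * n = 1 := by have := Nat.mul_pos hm hn; omega
    obtain ⟨rfl, rfl⟩ := mul_eq_one.mp h1
    norm_num
  · have he : 2 ∣ (m * n - 2) * (n - 1) := by
      rcases Nat.even_or_odd n with hE | hO
      · apply Dvd.dvd.mul_right
        exact Nat.dvd_sub (Dvd.dvd.mul_left hE.two_dvd m) (dvd_refl 2)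
      · apply Dvd.dvd.mul_left
        obtain ⟨k, hk⟩ := hO
        exact ⟨k, by omega⟩
    have := Nat.mul_div_cancel' he
    generalize (m * n - 2) * (n - 1) / 2 = c at this ⊢
    have h2 : ((2 * c : ℕ) : ℤ) = (((m * n - 2) * (n - 1) : ℕ) : ℤ) := by
      rw [this]
    rw [Nat.cast_mul, Nat.cast_mul, Nat.cast_sub h, Nat.cast_sub (show 1 ≤ n from hn)] at h2
    simpa using h2

lemma wordOf_true_sum {m n : ℕ} (l : Fin (m * n) → Fin n) (hl : Antitone l)
    (f : ℕ → ℕ) :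
    (∑ j : Fin ((m + 1) * n), if wordOf m n l j = true then f j else 0)
      = ∑ i : Fin (m * n), f (n - (l i : ℕ) + (i : ℕ)) := by
  classical
  rw [← Finset.sum_filter]
  have hL : (m + 1) * n = m * n + n := by ring
  symm
  apply Finset.sum_bij (fun (i : Fin (m * n)) _ =>
    (⟨n - (l i : ℕ) + (i : ℕ), by have := i.isLt; omega⟩ : Fin ((m + 1) * n)))
  · intro i _
    simp only [Finset.mem_filter, Finset.mem_univ, true_and, wordOf, decide_eq_true_eq]
    exact ⟨i, rfl⟩
  · intro a _ b _ h
    exact pos_inj l hl (by simpa using h)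
  · intro b hb
    simp only [Finset.mem_filter, Finset.mem_univ, true_and, wordOf, decide_eq_true_eq] at hb
    obtain ⟨i, hi⟩ := hb
    exact ⟨i, Finset.mem_univ _, Fin.ext hi.symm⟩
  · intro i _
    rfl

lemma memB_wordOf {m n : ℕ} (hm : 0 < m) (hn : 0 < n) (l : Fin (m * n) → Fin n)
    (h : memY m n l) : memB m n (wordOf m n l) := by
  obtain ⟨hC, hl⟩ := h
  have h1 : (Finset.univ.filter fun i => wordOf m n l i = true).card = m * n := by
    rw [Finset.card_filter, wordOf_true_sum l hl (fun _ => 1)]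
    simp
  have h2 : (Finset.univ.filter fun i => wordOf m n l i = false).card = n := by
    have := Finset.card_filter_add_card_filter_not (s := Finset.univ)
      (fun i => wordOf m n l i = true)
    simp only [Bool.not_eq_true, h1, Finset.card_univ, Fintype.card_fin] at this
    have hL : (m + 1) * n = m * n + n := by ring
    omega
  refine ⟨h1, h2, ?_, ?_⟩
  · intro i hi
    simp only [wordOf, decide_eq_false_iff_not, not_exists]
    intro a
    have := (l a).isLt
    omega
  · rw [wordOf_true_sum l hl (fun j => j + 1)]
    have hsum : ((∑ i : Fin (m * n), (n - (l i : ℕ) + (i : ℕ) + 1) : ℕ) : ℤ)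
        + ∑ i : Fin (m * n), ((l i : ℕ) : ℤ) = m * n * n + (∑ i : Fin (m * n), ((i : ℕ) : ℤ)) + m * n := by
      push_cast
      rw [← Finset.sum_add_distrib]
      have : ∀ i : Fin (m * n), (((n - (l i : ℕ) : ℕ) : ℤ) + (i : ℕ) + 1 + ((l i : ℕ) : ℤ))
          = n + (i : ℕ) + 1 := by
        intro i
        have := (l i).isLt
        omega
      simp only [this, Finset.sum_add_distrib]
      simp
    have hg : 2 * (∑ i : Fin (m * n), ((i : ℕ) : ℤ)) = (m * n : ℤ) * (m * n - 1) := by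
      have h0 := Finset.sum_range_id_mul_two (m * n)
      rw [← Fin.sum_univ_eq_sum_range (fun i => i)] at h0
      have hp : 1 ≤ m * n := Nat.mul_pos hm hn
      have : (((∑ i : Fin (m * n), (i : ℕ)) * 2 : ℕ) : ℤ) = ((m * n * (m * n - 1) : ℕ) : ℤ) := by
        rw [h0]
      push_cast [Nat.cast_sub hp] at this
      linarith
    have hc := two_cmn hm hn
    have hC' : (n : ℤ) ∣ (cmn m n : ℤ) - ∑ i : Fin (m * n), ((l i : ℕ) : ℤ) := by
      unfold memC at hC
      rw [← ZMod.intCast_zmod_eq_zero_iff_dvd]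
      push_cast at hC ⊢
      rw [hC, sub_self]
    obtain ⟨q, hq⟩ := hC'
    obtain ⟨e, he⟩ : ∃ e : ℤ, (m : ℤ) * (m - 1) = 2 * e := by
      obtain ⟨e, he⟩ := Int.even_mul_pred_self (m : ℤ)
      exact ⟨e, by linarith⟩
    set S : ℕ := ∑ i : Fin (m * n), (n - (l i : ℕ) + (i : ℕ) + 1) with hS
    have : (n : ℤ) ∣ (S : ℤ) + 1 := by
      refine ⟨m * n + q + n * e + m + 1, ?_⟩
      have : (2 : ℤ) * ((S : ℤ) + 1) = 2 * (n * (m * n + q + n * e + m + 1)) := by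
        linear_combination 2 * hsum + hg + (2:ℤ) * hq - hc + (n:ℤ)^2 * he
      linarith
    have h3 : (((S : ℤ) + 1 : ℤ) : ZMod n) = 0 := (ZMod.intCast_zmod_eq_zero_iff_dvd _ n).mpr this
    push_cast at h3
    exact eq_neg_of_add_eq_zero_left h3

lemma periodic_sum (f : ℕ → ℕ) (g : ℕ) (hf : ∀ i, f (i + g) = f i) (d : ℕ) :
    (∑ i ∈ Finset.range (d * g), f i = d * ∑ i ∈ Finset.range g, f i) ∧
    (∑ i ∈ Finset.range (d * g), f i * (i + 1)
      = d * (∑ i ∈ Finset.range g, f i * (i + 1))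
        + g * (∑ i ∈ Finset.range g, f i) * ∑ a ∈ Finset.range d, a) := by
  have hf' : ∀ d i, f (d * g + i) = f i := by
    intro d
    induction d with
    | zero => intro i; simp
    | succ d ih =>
      intro i
      rw [show (d + 1) * g + i = (d * g + i) + g by ring, hf, ih]
  induction d with
  | zero => simp
  | succ d ih =>
    obtain ⟨i1, i2⟩ := ih
    rw [show (d + 1) * g = d * g + g by ring, Finset.sum_range_add, Finset.sum_range_add, i1, i2]
    simp only [hf']
    constructor
    · ring
    · have : ∑ x ∈ Finset.range g, f x * (d * g + x + 1)
          = ∑ x ∈ Finset.range g, f x * (x + 1) + d * g * ∑ x ∈ Finset.range g, f x := by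
        rw [Finset.mul_sum, ← Finset.sum_add_distrib]
        apply Finset.sum_congr rfl
        intros; ring
      rw [this, Finset.sum_range_succ]
      ring

lemma primitive_aux {m n L : ℕ} (hL : L = (m + 1) * n) (hn : 0 < n) (w : Fin L → Bool)
    (h1 : (Finset.univ.filter fun i => w i = true).card = m * n)
    (h4 : ((∑ i : Fin L, if w i = true then (i : ℕ) + 1 else 0 : ℕ) : ZMod n) = -1)
    (j : ℕ) (hj : 0 < j) (hjL : j < L) : rot j w ≠ w := by
  intro hr
  have hLpos : 0 < L := by omega
  set F : ℕ → ℕ := fun i => if w ⟨i % L, Nat.mod_lt _ hLpos⟩ = true then 1 else 0 with hF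
  have hFj : ∀ i, F (i + j) = F i := by
    intro i
    have := congrFun hr ⟨i % L, Nat.mod_lt _ hLpos⟩
    simp only [rot, Nat.mod_add_mod] at this
    simp only [hF, this]
  have hFL : ∀ i, F (i + L) = F i := by
    intro i
    simp only [hF, Nat.add_mod_right]
  have hg : ∀ i, F (i + Nat.gcd j L) = F i := by
    have hk : ∀ k i, F (i + k * j) = F i := by
      intro k
      induction k with
      | zero => simp
      | succ k ih => intro i; rw [show i + (k + 1) * j = (i + k * j) + j by ring, hFj, ih]
    have hkL : ∀ k i, F (i + k * L) = F i := by
      intro k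
      induction k with
      | zero => simp
      | succ k ih => intro i; rw [show i + (k + 1) * L = (i + k * L) + L by ring, hFL, ih]
    obtain ⟨a, ha⟩ : ∃ a : ℕ, (a * j) % L = Nat.gcd j L := by
      obtain ⟨a, ha⟩ := Nat.exists_mul_mod_eq_gcd (n := j) (k := L)
        (lt_of_le_of_lt (Nat.gcd_le_left L hj) hjL)
      exact ⟨a, by rw [mul_comm]; exact ha.2⟩
    intro i
    rw [← hk a i, ← ha, ← hkL (a * j / L) (i + a * j % L)]
    congr 1
    have := Nat.mod_add_div (a * j) L
    rw [mul_comm L] at this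
    omega
  obtain ⟨d, hd⟩ := Nat.gcd_dvd_right j L
  set g := Nat.gcd j L with hgd
  have hgj : g ≤ j := Nat.gcd_le_left L hj
  have hd1 : d ≠ 1 := by rintro rfl; omega
  have hdL : d * g = L := by rw [hd]; ring
  obtain ⟨p1, p2⟩ := periodic_sum F g hg d
  rw [hdL, ← Fin.sum_univ_eq_sum_range F] at p1
  rw [hdL, ← Fin.sum_univ_eq_sum_range (fun i => F i * (i + 1))] at p2
  have hFi : ∀ i : Fin L, F i = if w i = true then 1 else 0 := by
    intro i
    simp only [hF, Nat.mod_eq_of_lt i.isLt]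
  have hdpos : 0 < d := by
    rcases Nat.eq_zero_or_pos d with h | h
    · subst h; omega
    · exact h
  simp only [hFi] at p1 p2
  rw [← Finset.card_filter, h1] at p1
  simp only [ite_mul, one_mul, zero_mul] at p2
  set T := ∑ i ∈ Finset.range g, F i with hT
  set wt := ∑ i : Fin L, if w i = true then (i : ℕ) + 1 else 0 with hwt
  -- n = d * (g - T)
  have hnz : (n : ℤ) = d * ((g : ℤ) - T) := by
    have e1 : ((d * g : ℕ) : ℤ) = (((m + 1) * n : ℕ) : ℤ) := by rw [hdL, hL]
    have e2 : ((m * n : ℕ) : ℤ) = ((d * T : ℕ) : ℤ) := by rw [p1]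
    push_cast at e1 e2
    linear_combination -e2 - e1
  obtain ⟨z, hz⟩ : ∃ z : ℤ, z = (g : ℤ) - T := ⟨_, rfl⟩
  rw [← hz] at hnz
  have hd0 : (d : ℤ) ≠ 0 := by exact_mod_cast hdpos.ne'
  have hTz : (T : ℤ) = m * z := by
    apply mul_left_cancel₀ hd0
    have e2 : ((m * n : ℕ) : ℤ) = ((d * T : ℕ) : ℤ) := by rw [p1]
    push_cast at e2
    linear_combination -e2 + (m : ℤ) * hnz
  have hgz : (g : ℤ) = (m + 1) * z := by linear_combination -hz + hTz
  obtain ⟨e, he⟩ : ∃ e : ℤ, (m : ℤ) * (m + 1) = 2 * e := by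
    obtain ⟨e, he⟩ := Int.even_mul_succ_self (m : ℤ)
    exact ⟨e, by linarith⟩
  have hA : 2 * ((∑ a ∈ Finset.range d, a : ℕ) : ℤ) = d * (d - 1) := by
    have h0 := Finset.sum_range_id_mul_two d
    have : (((∑ i ∈ Finset.range d, i) * 2 : ℕ) : ℤ) = ((d * (d - 1) : ℕ) : ℤ) := by rw [h0]
    rw [Nat.cast_mul, Nat.cast_mul, Nat.cast_sub (show 1 ≤ d from hdpos)] at this
    push_cast at this ⊢
    linarith
  set A := ∑ a ∈ Finset.range d, a with hAd
  have hdw : (d : ℤ) ∣ (wt : ℤ) := by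
    rw [p2]
    push_cast
    apply dvd_add (dvd_mul_right _ _)
    refine ⟨e * z ^ 2 * (d - 1), ?_⟩
    rw [hgz, hTz]
    linear_combination z ^ 2 * (A : ℤ) * he + e * z ^ 2 * hA
  have hnw : (n : ℤ) ∣ (wt : ℤ) + 1 := by
    rw [← ZMod.intCast_zmod_eq_zero_iff_dvd]
    push_cast
    rw [h4]
    ring
  have hdn : (d : ℤ) ∣ (wt : ℤ) + 1 := (Dvd.intro _ hnz.symm).trans hnw
  have : (d : ℤ) ∣ 1 := (Int.dvd_add_right hdw).mp hdn
  have : d ∣ 1 := by exact_mod_cast this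
  exact hd1 (Nat.dvd_one.mp this)

lemma primitive {m n : ℕ} (hn : 0 < n) (w : Fin ((m + 1) * n) → Bool) (hw : memB m n w)
    (j : ℕ) (hj : 0 < j) (hjL : j < (m + 1) * n) : rot j w ≠ w :=
  primitive_aux rfl hn w hw.1 hw.2.2.2 j hj hjL

lemma lexLt_iff {k : ℕ} (v w : Fin k → Bool) : lexLt v w ↔ toLex v < toLex w := Iff.rfl

/-- Lyndon words that are rotations of one another agree. -/
lemma lyndon_unique {k : ℕ} (v w : Fin k → Bool) (hv : isLyndon v) (hw : isLyndon w)
    (a b : ℕ) (h : rot a v = rot b w) : v = w := by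
  rcases Nat.eq_zero_or_pos k with hk | hk
  · subst hk; funext i; exact i.elim0
  have le : ∀ (u : Fin k → Bool), isLyndon u → ∀ c, toLex u ≤ toLex (rot c u) := by
    intro u hu c
    rw [← rot_mod]
    rcases Nat.eq_zero_or_pos (c % k) with h0 | h0
    · rw [h0, rot_zero]
    · have := Nat.mod_lt c hk
      exact le_of_lt ((lexLt_iff _ _).mp (hu (c % k) h0 (by omega)))
  have inv : ∀ (u u' : Fin k → Bool) (a b : ℕ), rot a u = rot b u' → ∃ c, u = rot c u' := by
    intro u u' a b h
    refine ⟨(k - a % k) + b, ?_⟩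
    rw [← rot_rot, ← h, ← rot_mod a, rot_rot, Nat.sub_add_cancel (Nat.mod_lt a hk).le, rot_self]
  obtain ⟨c, hc⟩ := inv v w a b h
  obtain ⟨c', hc'⟩ := inv w v b a h.symm
  have h1 := le w hw c
  rw [← hc] at h1
  have h2 := le v hv c'
  rw [← hc'] at h2
  exact toLex.injective (le_antisymm h2 h1)

theorem lyndon_orbit_representatives (m n : ℕ) (hm : 0 < m) (hn : 0 < n)
    (x : Fin (m * n) → Fin n) (hx : memC m n x) :
    ∃! w : Fin ((m + 1) * n) → Bool, (memB m n w ∧ isLyndon w) ∧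
      ∃ l : Fin (m * n) → Fin n, memY m n l ∧ wordOf m n l = w ∧
        ∃ j < n, ∃ σ : Equiv.Perm (Fin (m * n)), x = shift^[j] (l ∘ σ) := by
  have hLpos : 0 < (m + 1) * n := by positivity
  apply existsUnique_of_exists_of_unique
  · obtain ⟨a, ha, hmin⟩ := Finset.exists_min_image (Finset.range ((m + 1) * n))
      (fun a => toLex (rot a (Wd m n x))) ⟨0, Finset.mem_range.mpr hLpos⟩
    rw [Finset.mem_range] at ha
    have hmin' : ∀ b, toLex (rot a (Wd m n x)) ≤ toLex (rot b (Wd m n x)) := by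
      intro b
      rw [← rot_mod b]
      exact hmin _ (Finset.mem_range.mpr (Nat.mod_lt _ hLpos))
    have hw0 : Wd m n x ⟨0, hLpos⟩ = false :=
      (Wd_false x _).mpr ⟨0, hn, (zp_zero x).symm⟩
    have hv0 : Wd m n x ⟨a, ha⟩ = false := by
      by_contra hc
      rw [Bool.not_eq_false] at hc
      apply not_lt_of_ge (hmin' 0)
      rw [rot_zero]
      apply (lexLt_iff _ _).mp
      refine ⟨⟨0, hLpos⟩, ?_, ?_⟩
      · intro i' hi'
        exact absurd hi' (by simp [Fin.lt_def])
      · rw [hw0]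
        simp only [rot, zero_add, Nat.mod_eq_of_lt ha, hc]
        decide
    obtain ⟨k, hk, hak⟩ := (Wd_false x _).mp hv0
    simp only at hak
    have hv : Wd m n (shift^[k] x) = rot a (Wd m n x) := by
      rw [Wd_shift_iter hn k hk.le, hak]
    obtain ⟨σ, hσ⟩ : ∃ σ : Equiv.Perm (Fin (m * n)), Antitone ((shift^[k] x) ∘ σ) :=
      ⟨Tuple.sort (OrderDual.toDual ∘ (shift^[k] x)),
        fun i j hij => Tuple.monotone_sort (OrderDual.toDual ∘ (shift^[k] x)) hij⟩
    have hY : memY m n ((shift^[k] x) ∘ σ) := ⟨memC_perm _ (memC_shift_iter x hx k) σ, hσ⟩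
    have hword : wordOf m n ((shift^[k] x) ∘ σ) = rot a (Wd m n x) := by
      rw [wordOf_eq_Wd _ hσ, Wd_perm, hv]
    have hB := memB_wordOf hm hn _ hY
    rw [hword] at hB
    refine ⟨rot a (Wd m n x), ⟨hB, ?_⟩, _, hY, hword, (n - k) % n, Nat.mod_lt _ hn, σ⁻¹, ?_⟩
    · intro j hj1 hj2
      apply (lexLt_iff _ _).mpr
      apply lt_of_le_of_ne
      · rw [rot_rot]; exact hmin' _
      · intro h
        exact primitive hn _ hB j hj1 (by omega) (toLex.injective h).symm
    · funext i
      apply Fin.ext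
      rw [shift_iter_val]
      simp only [Function.comp_apply, show σ (σ⁻¹ i) = i from σ.apply_symm_apply i]
      rw [shift_iter_val, ← Nat.add_mod, add_assoc, Nat.add_sub_cancel' hk.le,
        Nat.add_mod_right, Nat.mod_eq_of_lt (x i).isLt]
  · rintro w w' ⟨⟨-, hw⟩, l, ⟨-, hl⟩, hlw, j, hj, σ, hxj⟩
      ⟨⟨-, hw'⟩, l', ⟨-, hl'⟩, hlw', j', hj', σ', hxj'⟩
    have e1 : Wd m n x = rot (zp (l ∘ σ) j) w := by
      rw [hxj, Wd_shift_iter hn j hj.le, Wd_perm, ← wordOf_eq_Wd l hl, hlw]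
    have e2 : Wd m n x = rot (zp (l' ∘ σ') j') w' := by
      rw [hxj', Wd_shift_iter hn j' hj'.le, Wd_perm, ← wordOf_eq_Wd l' hl', hlw']
    exact lyndon_unique w w' hw hw' _ _ (e1.symm.trans e2)
end

section
/- Let m, n be positive integers and N = mn. Let K be the number of equivalence classes of C_{m,n} under the relation x ∼ y iff y = shift^j(σ · x) for some j ∈ {0,…,n−1} and some permutation σ ∈ S_N acting by permuting coordinates. Then n² · K = Σ_{d | n} (−1)^{m(n+d)} · μ(n/d) · C((m+1)d − 1, md), where μ is the Möbius function and the sum is over positive divisors d of n. -/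
/-- `x ∼ y` iff `y = shiftʲ(σ·x)` for some `0 ≤ j ≤ n-1` and some permutation `σ`
of the coordinates. -/
def orbitRel (m n : ℕ) (x y : {x : Fin (m * n) → Fin n // memC m n x}) : Prop :=
  ∃ j < n, ∃ σ : Equiv.Perm (Fin (m * n)),
    (y : Fin (m * n) → Fin n) = shift^[j] ((x : Fin (m * n) → Fin n) ∘ σ)

lemma aux_sum_periodic (F : ℕ → ℕ) (d : ℕ) (hF : ∀ k, F (k + d) = F k) (p : ℕ) :
    (∑ k ∈ Finset.range (p * d), F k = p * ∑ k ∈ Finset.range d, F k) ∧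
    ∑ k ∈ Finset.range (p * d), k * F k =
      p * (∑ k ∈ Finset.range d, k * F k) +
        d * (∑ k ∈ Finset.range p, k) * ∑ k ∈ Finset.range d, F k := by
  have hF' : ∀ p k, F (p * d + k) = F k := by
    intro p k
    induction p with
    | zero => simp
    | succ p ih =>
      rw [← ih, ← hF (p * d + k)]
      congr 1
      ring
  induction p with
  | zero => simp
  | succ p ih =>
    obtain ⟨h1, h2⟩ := ih
    rw [Nat.succ_mul, Finset.sum_range_add, Finset.sum_range_add, h1, h2,
      Finset.sum_range_succ]
    simp only [hF', add_mul, Finset.sum_add_distrib, ← Finset.mul_sum]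
    constructor <;> ring

lemma aux_two_cmn (m n : ℕ) : 2 * cmn m n = (m * n - 2) * (n - 1) := by
  unfold cmn
  apply Nat.mul_div_cancel'
  rcases Nat.even_or_odd n with h | h
  · apply Dvd.dvd.mul_right
    apply Nat.dvd_sub
    · exact (h.two_dvd).mul_left m
    · exact dvd_rfl
  · apply Dvd.dvd.mul_left
    obtain ⟨k, rfl⟩ := h
    simp

lemma aux_free_prime (m d p : ℕ) (hm : 0 < m) (hd : 0 < d) (hp : p.Prime) (F : ℕ → ℕ)
    (hF : ∀ k, F (k + d) = F k)
    (h1 : ∑ k ∈ Finset.range (p * d), F k = m * (p * d))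
    (h2 : ∑ k ∈ Finset.range (p * d), k * F k ≡ cmn m (p * d) [MOD (p * d)]) : False := by
  obtain ⟨e1, e2⟩ := aux_sum_periodic F d hF p
  rw [e1] at h1
  have hB : ∑ k ∈ Finset.range d, F k = m * d := by
    apply Nat.eq_of_mul_eq_mul_left hp.pos
    rw [h1]; ring
  rw [e2, hB] at h2
  have h3 := Nat.ModEq.of_mul_right d h2
  have hc := aux_two_cmn m (p * d)
  have hT := Finset.sum_range_id_mul_two p
  have hmd : 0 < m * d := Nat.mul_pos hm hd
  generalize ∑ k ∈ Finset.range d, k * F k = A at h3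
  generalize (∑ k ∈ Finset.range p, k) = T at h3 hT
  rcases hp.eq_two_or_odd' with rfl | hodd
  · have hT' : T = 1 := by omega
    subst hT'
    obtain ⟨t, ht⟩ : ∃ t, m * d = t + 1 := ⟨m * d - 1, by omega⟩
    obtain ⟨s, rfl⟩ : ∃ s, d = s + 1 := ⟨d - 1, by omega⟩
    have e : m * (2 * (s + 1)) - 2 = 2 * t := by
      have : m * (2 * (s + 1)) = 2 * (m * (s + 1)) := by ring
      omega
    have e' : 2 * (s + 1) - 1 = 2 * s + 1 := by omega
    rw [e, e'] at hc
    have hc' : cmn m (2 * (s + 1)) = t * (2 * s + 1) := by nlinarith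
    rw [hc', ht] at h3
    have h4 : (s + 1) * (t + 1) ≡ t [MOD 2] := by
      have a1 : 2 * A + (s + 1) * 1 * (t + 1) ≡ (s + 1) * (t + 1) [MOD 2] := by
        simp [Nat.ModEq]
      have a2 : t * (2 * s + 1) ≡ t [MOD 2] := by
        have : t * (2 * s + 1) = t + 2 * (t * s) := by ring
        rw [this]; simp [Nat.ModEq]
      exact a1.symm.trans (h3.trans a2)
    have h5 : Even ((s + 1) * (t + 1)) ↔ Even t := by
      rw [Nat.even_iff, Nat.even_iff, h4]
    have h6 : Even (t + 1) ↔ Even m ∨ Even (s + 1) := by rw [← ht, Nat.even_mul]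
    rw [Nat.even_mul] at h5
    have h7 : Even (t + 1) ↔ ¬ Even t := Nat.even_add_one
    tauto
  · have hp3 : 3 ≤ p := by
      have := hp.two_le
      rcases hodd with ⟨k, hk⟩
      omega
    have h4 : p ∣ T := by
      have : p ∣ T * 2 := ⟨_, hT⟩
      exact (Nat.Coprime.dvd_of_dvd_mul_right (by simpa using hodd) this)
    have h5 : p ∣ cmn m (p * d) := by
      refine (Nat.ModEq.dvd_iff h3 dvd_rfl).1 ?_
      exact dvd_add (Dvd.intro _ rfl) ((h4.mul_left d).mul_right _)
    have h6 : p ∣ (m * (p * d) - 2) * (p * d - 1) := hc ▸ h5.mul_left 2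
    have hpd : p ≤ p * d := Nat.le_mul_of_pos_right p hd
    have hmpd : p * d ≤ m * (p * d) := Nat.le_mul_of_pos_left _ hm
    rcases (Nat.Prime.dvd_mul hp).1 h6 with h | h
    · have : p ∣ m * (p * d) - (m * (p * d) - 2) :=
        Nat.dvd_sub ((Dvd.intro d rfl).mul_left m) h
      have e : m * (p * d) - (m * (p * d) - 2) = 2 := by omega
      rw [e] at this
      have := Nat.le_of_dvd (by norm_num) this
      omega
    · have : p ∣ p * d - (p * d - 1) := Nat.dvd_sub (Dvd.intro d rfl) h
      have e : p * d - (p * d - 1) = 1 := by omega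
      rw [e] at this
      have := Nat.le_of_dvd (by norm_num) this
      omega

lemma aux_free (m n g : ℕ) (hm : 0 < m) (hg0 : 0 < g) (hgn : g < n) (F : ℕ → ℕ)
    (hn : ∀ k, F (k + n) = F k) (hF : ∀ k, F (k + g) = F k)
    (h1 : ∑ k ∈ Finset.range n, F k = m * n)
    (h2 : ∑ k ∈ Finset.range n, k * F k ≡ cmn m n [MOD n]) : False := by
  have hmul : ∀ (t : ℕ), (∀ k, F (k + t) = F k) → ∀ q k, F (k + q * t) = F k := by
    intro t ht q
    induction q with
    | zero => simp
    | succ q ih =>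
      intro k
      rw [Nat.succ_mul, ← add_assoc, ht, ih]
  -- gcd period
  have hgcd : ∀ k, F (k + Nat.gcd g n) = F k := by
    intro k
    have hlt : Nat.gcd g n < n := (Nat.gcd_le_left _ hg0).trans_lt hgn
    obtain ⟨u, -, hu⟩ := Nat.exists_mul_mod_eq_gcd hlt
    have h3 := Nat.div_add_mod (g * u) n
    rw [hu] at h3
    rw [← hmul n hn (g * u / n) (k + Nat.gcd g n), ← hmul g hF u k]
    congr 1
    rw [mul_comm u g, mul_comm (g * u / n) n]
    omega
  obtain ⟨e, he⟩ := Nat.gcd_dvd_right g n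
  set d := Nat.gcd g n with hd
  have hd0 : 0 < d := Nat.gcd_pos_of_pos_left _ hg0
  have hdg : d ≤ g := Nat.gcd_le_left _ hg0
  have he1 : e ≠ 1 := by rintro rfl; omega
  obtain ⟨p, hp, q, rfl⟩ := Nat.exists_prime_and_dvd he1
  have hnq : n = p * (q * d) := by rw [he]; ring
  have hqd : 0 < q * d := by
    rcases Nat.eq_zero_or_pos (q * d) with h | h
    · rw [h] at hnq; omega
    · exact h
  rw [hnq] at h1 h2
  exact aux_free_prime m (q * d) p hm hqd hp F (hmul d hgcd q) h1 h2

lemma aux_inj {R : Type*} [CommRing R] [IsDomain R] {e : ℕ} {ζ : R}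
    (h : IsPrimitiveRoot ζ e) : Set.InjOn (fun a : ℕ => ζ ^ a) (Finset.range e : Finset ℕ) := by
  intro a ha b hb hab
  exact h.pow_inj (by simpa using ha) (by simpa using hb) hab

lemma aux_roots {R : Type*} [CommRing R] [IsDomain R] [DecidableEq R] {e : ℕ} (he : 0 < e) {ζ : R}
    (h : IsPrimitiveRoot ζ e) :
    Polynomial.nthRootsFinset e (1 : R) = (Finset.range e).image (fun a => ζ ^ a) := by
  symm
  apply Finset.eq_of_subset_of_card_le
  · intro z hz
    obtain ⟨a, -, rfl⟩ := Finset.mem_image.1 hz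
    rw [Polynomial.mem_nthRootsFinset he, ← pow_mul, mul_comm, pow_mul, h.pow_eq_one, one_pow]
  · rw [h.card_nthRootsFinset, Finset.card_image_of_injOn (aux_inj h), Finset.card_range]

lemma aux_orth (n : ℕ) (hn : 0 < n) (s c : ℕ) :
    ∑ z ∈ Polynomial.nthRootsFinset n (1 : ℂ), z ^ s * z⁻¹ ^ c =
      if s ≡ c [MOD n] then (n : ℂ) else 0 := by
  have hζ := Complex.isPrimitiveRoot_exp n hn.ne'
  set ζ := Complex.exp (2 * Real.pi * Complex.I / n) with hζd
  have hζ0 : ζ ≠ 0 := Complex.exp_ne_zero _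
  rw [aux_roots hn hζ, Finset.sum_image (aux_inj hζ)]
  have e1 : ∀ a, (ζ ^ a) ^ s * (ζ ^ a)⁻¹ ^ c = (ζ ^ s * ζ⁻¹ ^ c) ^ a := by
    intro a
    rw [mul_pow, ← pow_mul, ← pow_mul, ← inv_pow, ← pow_mul, ← pow_mul, mul_comm a s, mul_comm a c]
  simp only [e1]
  have e2 : ζ ^ s * ζ⁻¹ ^ c = 1 ↔ s ≡ c [MOD n] := by
    rw [inv_pow, mul_inv_eq_one₀ (pow_ne_zero _ hζ0), hζ.eq_orderOf]
    have h := pow_eq_pow_iff_modEq (x := Units.mk0 ζ hζ0) (m := c) (n := s)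
    rw [← orderOf_units, Units.ext_iff] at h
    simpa using h
  split_ifs with h
  · rw [e2.2 h]; simp
  · have h1 : ζ ^ s * ζ⁻¹ ^ c ≠ 1 := fun h' => h (e2.1 h')
    rw [geom_sum_eq h1, mul_pow, ← pow_mul, ← pow_mul, mul_comm s, mul_comm c, pow_mul, pow_mul,
      inv_pow, hζ.pow_eq_one]
    simp

lemma aux_pow_cmn {z : ℂ} {e d m : ℕ} (he : 0 < e) (hd : 0 < d) (hm : 0 < m)
    (hz : IsPrimitiveRoot z e) :
    z⁻¹ ^ cmn m (d * e) = (-1) ^ (m * (d * e + d)) * z⁻¹ := by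
  have hz0 : z ≠ 0 := hz.ne_zero he.ne'
  have hzn : z ^ (d * e) = 1 := by rw [mul_comm, pow_mul, hz.pow_eq_one, one_pow]
  have hde : 0 < d * e := Nat.mul_pos hd he
  obtain ⟨t, ht⟩ : ∃ t, d * e * (d * e - 1) = 2 * t := by
    obtain ⟨t, ht⟩ := Nat.even_mul_pred_self (d * e)
    exact ⟨t, by omega⟩
  have hc := aux_two_cmn m (d * e)
  have hct : cmn m (d * e) + (d * e - 1) = m * t := by
    rcases Nat.lt_or_ge (m * (d * e)) 2 with h | h
    · have : d * e ≤ m * (d * e) := Nat.le_mul_of_pos_left _ hm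
      have h1 : d * e = 1 := by omega
      rw [h1] at ht hc ⊢
      have : t = 0 := by omega
      subst this
      simp at hc ⊢
      exact hc
    · obtain ⟨k, hk⟩ := Nat.exists_eq_add_of_le h
      have e1 : m * (d * e) - 2 = k := by omega
      rw [e1] at hc
      generalize d * e - 1 = v at *
      have : m * (d * e) * v = m * (2 * t) := by rw [← ht]; ring
      rw [hk] at this
      nlinarith
  have hzt : z ^ t = (-1) ^ (d * e + d) := by
    rcases Nat.even_or_odd (d * e) with h | h
    · rcases Nat.even_or_odd d with h' | h'
      · obtain ⟨k, rfl⟩ := h'.two_dvd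
        have : t = e * (k * (2 * k * e - 1)) := by
          have : 2 * t = 2 * (e * (k * (2 * k * e - 1))) := by rw [← ht]; ring
          omega
        rw [this, pow_mul, hz.pow_eq_one, one_pow]
        exact (Even.neg_one_pow (h.add h')).symm
      · have h2 : Even e := by
          rcases Nat.even_mul.1 h with h3 | h3
          · exact absurd h3 (Nat.not_even_iff_odd.2 h')
          · exact h3
        obtain ⟨k, rfl⟩ := h2.two_dvd
        have hk : z ^ k = -1 := by
          have h4 : z ^ k * z ^ k = 1 := by
            rw [← pow_add, ← two_mul, hz.pow_eq_one]
          rcases mul_self_eq_one_iff.1 h4 with h5 | h5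
          · have := Nat.le_of_dvd (by omega) (hz.dvd_of_pow_eq_one k h5)
            omega
          · exact h5
        have : t = k * (d * (d * (2 * k) - 1)) := by
          have : 2 * t = 2 * (k * (d * (d * (2 * k) - 1))) := by rw [← ht]; ring
          omega
        rw [this, pow_mul, hk, Odd.neg_one_pow, Odd.neg_one_pow]
        · exact h.add_odd h'
        · exact h'.mul (Nat.Even.sub_odd hde h odd_one)
    · have h' : Odd d := (Nat.odd_mul.1 h).1
      obtain ⟨k, hk⟩ := h
      have : t = (d * e) * k := by
        have : 2 * t = 2 * ((d * e) * k) := by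
          rw [← ht, show d * e - 1 = 2 * k by omega]; ring
        omega
      rw [this, pow_mul, hzn, one_pow]
      exact (Even.neg_one_pow (Odd.add_odd ⟨k, hk⟩ h')).symm
  have h1 : z ^ cmn m (d * e) = z * (-1) ^ (m * (d * e + d)) := by
    have h2 : z ^ (cmn m (d * e) + (d * e - 1)) * z = z ^ (m * t) * z := by rw [hct]
    rw [← pow_succ, add_assoc, Nat.sub_add_cancel hde, pow_add, hzn, mul_one] at h2
    rw [h2, mul_comm m t, pow_mul, hzt, ← pow_mul, mul_comm m, mul_comm]
  rw [inv_pow, h1, mul_inv, ← inv_pow, inv_neg_one, mul_comm]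

lemma aux_mk_mul (r : ℂ) : (PowerSeries.mk (fun j => r ^ j)) * (1 - PowerSeries.C r * PowerSeries.X) = 1 := by
  have := congrArg (PowerSeries.rescale r) (PowerSeries.mk_one_mul_one_sub_eq_one ℂ)
  rw [map_mul, map_sub, map_one, PowerSeries.rescale_X, PowerSeries.rescale_mk] at this
  simpa using this

lemma aux_prod_range {z : ℂ} {e : ℕ} (he : 0 < e) (hz : IsPrimitiveRoot z e) :
    ∏ a ∈ Finset.range e, (1 - PowerSeries.C (z ^ a) * PowerSeries.X) = 1 - (PowerSeries.X : PowerSeries ℂ) ^ e := by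
  have hz' : IsPrimitiveRoot (PowerSeries.C z) e := hz.map_of_injective PowerSeries.C_injective
  have := hz'.pow_sub_pow_eq_prod_sub_mul 1 (PowerSeries.X : PowerSeries ℂ) he
  rw [one_pow] at this
  rw [this]
  classical
  rw [aux_roots he hz', Finset.prod_image (aux_inj hz')]
  simp

lemma aux_prod_range' {z : ℂ} {e : ℕ} (he : 0 < e) (hz : IsPrimitiveRoot z e) (d : ℕ) :
    ∏ a ∈ Finset.range (d * e), (1 - PowerSeries.C (z ^ a) * PowerSeries.X) =
      (1 - (PowerSeries.X : PowerSeries ℂ) ^ e) ^ d := by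
  induction d with
  | zero => simp
  | succ d ih =>
    rw [Nat.succ_mul, Finset.prod_range_add, ih, pow_succ, ← aux_prod_range he hz]
    congr 1
    refine Finset.prod_congr rfl fun a _ => ?_
    rw [pow_add, mul_comm d e, pow_mul, hz.pow_eq_one, one_pow, one_mul]

lemma aux_coeff {z : ℂ} {e : ℕ} (he : 0 < e) (hz : IsPrimitiveRoot z e) (m d : ℕ) (hd : 0 < d) :
    PowerSeries.coeff (m * (d * e)) (∏ a ∈ Finset.range (d * e), PowerSeries.mk (fun j => (z ^ a) ^ j)) =
      (((m + 1) * d - 1).choose (m * d) : ℂ) := by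
  have key : ∏ a ∈ Finset.range (d * e), PowerSeries.mk (fun j => (z ^ a) ^ j) =
      PowerSeries.expand e he.ne' (PowerSeries.invOneSubPow ℂ d).val := by
    have h1 : (∏ a ∈ Finset.range (d * e), PowerSeries.mk (fun j => (z ^ a) ^ j)) *
      (1 - (PowerSeries.X : PowerSeries ℂ) ^ e) ^ d = 1 := by
      rw [← aux_prod_range' he hz, ← Finset.prod_mul_distrib]
      exact Finset.prod_eq_one fun a _ => aux_mk_mul _
    have h2 : PowerSeries.expand e he.ne' (PowerSeries.invOneSubPow ℂ d).val *
      (1 - (PowerSeries.X : PowerSeries ℂ) ^ e) ^ d = 1 := by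
      have := (PowerSeries.invOneSubPow ℂ d).val_inv
      rw [PowerSeries.invOneSubPow_inv_eq_one_sub_pow] at this
      have := congrArg (PowerSeries.expand e he.ne') this
      simpa using this
    exact mul_right_cancel₀ (right_ne_zero_of_mul_eq_one h1) (h1.trans h2.symm)
  rw [key, show m * (d * e) = e * (m * d) by ring, PowerSeries.coeff_expand_mul,
    PowerSeries.invOneSubPow_val_eq_mk_sub_one_add_choose_of_pos _ _ hd, PowerSeries.coeff_mk]
  have : (m + 1) * d - 1 = d - 1 + m * d := by
    rw [add_mul]; omega
  rw [this, Nat.choose_symm_add]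

lemma aux_ramanujan (e : ℕ) (he : 0 < e) :
    ∑ z ∈ primitiveRoots e ℂ, z⁻¹ = (ArithmeticFunction.moebius e : ℂ) := by
  have := (ArithmeticFunction.sum_eq_iff_sum_mul_moebius_eq (R := ℂ)
    (f := fun e => ∑ z ∈ primitiveRoots e ℂ, z⁻¹) (g := fun n => if n = 1 then 1 else 0)).1 ?_ e he
  · rw [← this]
    rw [Finset.sum_eq_single (e, 1)]
    · simp
    · rintro ⟨a, b⟩ hab hne
      simp only [Nat.mem_divisorsAntidiagonal] at hab
      rw [if_neg, mul_zero]
      rintro rfl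
      simp at hab hne
      omega
    · simp [he.ne']
  · intro n hn
    have h := aux_orth n hn 0 1
    rw [IsPrimitiveRoot.nthRoots_one_eq_biUnion_primitiveRoots, Finset.sum_biUnion] at h
    · simp only [pow_zero, one_mul, pow_one] at h
      rw [h]
      by_cases h1 : n = 1
      · subst h1; simp [Nat.modEq_one]
      · rw [if_neg h1, if_neg]
        intro h2
        have := (Nat.modEq_zero_iff_dvd.1 h2.symm)
        exact h1 (Nat.dvd_one.1 this)
    · intro a _ b _ hab
      exact IsPrimitiveRoot.disjoint hab

/-- Count vectors of total `m * n` and weighted sum `cmn m n` modulo `n`. -/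
def auxT (m n : ℕ) : Finset (Fin n → ℕ) :=
  (Finset.piAntidiag Finset.univ (m * n)).filter
    (fun f => ∑ a : Fin n, (a : ℕ) * f a ≡ cmn m n [MOD n])

lemma aux_T_card (m n : ℕ) (hm : 0 < m) (hn : 0 < n) :
    (n : ℤ) * (auxT m n).card = ∑ d ∈ n.divisors, (-1 : ℤ) ^ (m * (n + d)) *
        ArithmeticFunction.moebius (n / d) * ((m + 1) * d - 1).choose (m * d) := by
  have main : (n : ℂ) * (auxT m n).card = ∑ d ∈ n.divisors, (-1 : ℂ) ^ (m * (n + d)) *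
        ArithmeticFunction.moebius (n / d) * ((m + 1) * d - 1).choose (m * d) := by
    have hco : ∀ z : ℂ, PowerSeries.coeff (m * n)
        (∏ a ∈ Finset.range n, PowerSeries.mk (fun j => (z ^ a) ^ j)) =
        ∑ f ∈ Finset.piAntidiag (Finset.univ : Finset (Fin n)) (m * n),
          z ^ (∑ a : Fin n, (a : ℕ) * f a) := by
      intro z
      rw [Finset.prod_range, PowerSeries.coeff_prod]
      refine Finset.sum_bij' (fun f _ => (f : Fin n → ℕ))
        (fun f _ => Finsupp.equivFunOnFinite.symm f) ?_ ?_ ?_ ?_ ?_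
      · intro f hf
        simpa using hf
      · intro f hf
        simpa using hf
      · intro f hf
        ext; simp
      · intro f hf
        ext; simp
      · intro f hf
        rw [← Finset.prod_pow_eq_pow_sum]
        refine Finset.prod_congr rfl fun a _ => ?_
        rw [PowerSeries.coeff_mk, pow_mul]
    calc (n : ℂ) * (auxT m n).card
        = ∑ f ∈ Finset.piAntidiag (Finset.univ : Finset (Fin n)) (m * n),
          ∑ z ∈ Polynomial.nthRootsFinset n (1 : ℂ),
            z ^ (∑ a : Fin n, (a : ℕ) * f a) * z⁻¹ ^ cmn m n := by
          simp only [aux_orth n hn]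
          rw [← Finset.sum_filter, Finset.sum_const, nsmul_eq_mul, mul_comm]
          rfl
      _ = ∑ z ∈ Polynomial.nthRootsFinset n (1 : ℂ), PowerSeries.coeff (m * n)
            (∏ a ∈ Finset.range n, PowerSeries.mk (fun j => (z ^ a) ^ j)) * z⁻¹ ^ cmn m n := by
          rw [Finset.sum_comm]
          refine Finset.sum_congr rfl fun z _ => ?_
          rw [hco, Finset.sum_mul]
      _ = ∑ e ∈ n.divisors, ∑ z ∈ primitiveRoots e ℂ, PowerSeries.coeff (m * n)
            (∏ a ∈ Finset.range n, PowerSeries.mk (fun j => (z ^ a) ^ j)) * z⁻¹ ^ cmn m n := by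
          rw [IsPrimitiveRoot.nthRoots_one_eq_biUnion_primitiveRoots, Finset.sum_biUnion]
          intro a _ b _ hab
          exact IsPrimitiveRoot.disjoint hab
      _ = ∑ e ∈ n.divisors, (-1 : ℂ) ^ (m * (n + n / e)) *
        ArithmeticFunction.moebius e * ((m + 1) * (n / e) - 1).choose (m * (n / e)) := by
          refine Finset.sum_congr rfl fun e he => ?_
          have he0 : 0 < e := Nat.pos_of_mem_divisors he
          obtain ⟨d, hd⟩ := Nat.dvd_of_mem_divisors he
          have hd' : n = d * e := by rw [hd, mul_comm]
          have hd0 : 0 < d := by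
            rcases Nat.eq_zero_or_pos d with h | h
            · subst h; omega
            · exact h
          have hq : n / e = d := by rw [hd', Nat.mul_div_cancel _ he0]
          rw [hq, ← aux_ramanujan e he0, Finset.mul_sum, Finset.sum_mul]
          refine Finset.sum_congr rfl fun z hz => ?_
          have hz' := (mem_primitiveRoots he0).1 hz
          subst hd'
          rw [aux_coeff he0 hz' m d hd0, aux_pow_cmn he0 hd0 hm hz', mul_comm]
      _ = _ := by
          rw [← Nat.sum_div_divisors n (fun e => (-1 : ℂ) ^ (m * (n + n / e)) *
            ArithmeticFunction.moebius e * ((m + 1) * (n / e) - 1).choose (m * (n / e)))]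
          refine Finset.sum_congr rfl fun d hd => ?_
          rw [Nat.div_div_self (Nat.dvd_of_mem_divisors hd) hn.ne']
  exact_mod_cast main

/-- Fibre sizes of a tuple. -/
def auxCnt {N n : ℕ} (x : Fin N → Fin n) : Fin n → ℕ :=
  fun a => (Finset.univ.filter (fun i => x i = a)).card

/-- Fibre sizes of a tuple, as a periodic function on the naturals. -/
def auxCntN {N n : ℕ} (x : Fin N → Fin n) (k : ℕ) : ℕ :=
  (Finset.univ.filter (fun i => (x i : ℕ) ≡ k [MOD n])).card

lemma auxCntN_eq {N n : ℕ} (hn : 0 < n) (x : Fin N → Fin n) (k : ℕ) :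
    auxCntN x k = auxCnt x ⟨k % n, Nat.mod_lt _ hn⟩ := by
  unfold auxCntN auxCnt
  congr 1
  ext i
  simp only [Finset.mem_filter, Finset.mem_univ, true_and, Fin.ext_iff]
  unfold Nat.ModEq
  rw [Nat.mod_eq_of_lt (x i).isLt]

lemma auxCntN_val {N n : ℕ} (x : Fin N → Fin n) (a : Fin n) :
    auxCntN x a = auxCnt x a := by
  rw [auxCntN_eq a.pos]
  congr 1
  ext
  exact Nat.mod_eq_of_lt a.isLt

lemma aux_shift_val {N n : ℕ} (j : ℕ) (x : Fin N → Fin n) (i : Fin N) :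
    ((shift^[j] x i : Fin n) : ℕ) = (x i + j) % n := by
  induction j with
  | zero => simp [Nat.mod_eq_of_lt (x i).isLt]
  | succ j ih =>
    rw [Function.iterate_succ_apply']
    change (((shift^[j] x i : Fin n) : ℕ) + 1) % n = _
    rw [ih, Nat.mod_add_mod, add_assoc]

lemma aux_shift_modEq {N n : ℕ} (j : ℕ) (x : Fin N → Fin n) (i : Fin N) :
    ((shift^[j] x i : Fin n) : ℕ) ≡ x i + j [MOD n] := by
  rw [aux_shift_val]
  exact Nat.mod_modEq _ _

lemma auxCntN_shift {N n : ℕ} (j : ℕ) (x : Fin N → Fin n) (k : ℕ) :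
    auxCntN (shift^[j] x) (k + j) = auxCntN x k := by
  unfold auxCntN
  congr 1
  ext i
  simp only [Finset.mem_filter, Finset.mem_univ, true_and]
  have h := aux_shift_modEq j x i
  constructor
  · intro h'
    exact Nat.ModEq.add_right_cancel' j (h.symm.trans h')
  · intro h'
    exact h.trans (h'.add_right j)

lemma auxCnt_sum {N n : ℕ} (x : Fin N → Fin n) (g : Fin n → ℕ) :
    ∑ a, g a * auxCnt x a = ∑ i, g (x i) := by
  unfold auxCnt
  simp only [Finset.card_filter, Finset.mul_sum]
  rw [Finset.sum_comm]
  refine Finset.sum_congr rfl fun i _ => ?_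
  simp

lemma auxCnt_mem {m n : ℕ} (x : Fin (m * n) → Fin n) :
    auxCnt x ∈ auxT m n ↔ memC m n x := by
  have h1 := auxCnt_sum x (fun _ => 1)
  have h2 := auxCnt_sum x (fun a => (a : ℕ))
  simp only [one_mul, Finset.sum_const, Finset.card_univ, Fintype.card_fin, smul_eq_mul,
    mul_one] at h1
  unfold auxT memC
  rw [ZMod.natCast_eq_natCast_iff, Finset.mem_filter, h2]
  simp [h1]

lemma aux_memC_shift {m n : ℕ} (j : ℕ) (x : Fin (m * n) → Fin n) (hx : memC m n x) :
    memC m n (shift^[j] x) := by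
  unfold memC at *
  rw [← hx, ZMod.natCast_eq_natCast_iff]
  have h : ∑ i, ((shift^[j] x i : Fin n) : ℕ) ≡ ∑ i, ((x i : ℕ) + j) [MOD n] := by
    rw [← ZMod.natCast_eq_natCast_iff]
    push_cast
    refine Finset.sum_congr rfl fun i _ => ?_
    have := (ZMod.natCast_eq_natCast_iff _ _ _).2 (aux_shift_modEq j x i)
    simpa using this
  refine h.trans ?_
  rw [Finset.sum_add_distrib]
  simp only [Finset.sum_const, Finset.card_univ, Fintype.card_fin, smul_eq_mul]
  have : m * n * j = n * (m * j) := by ring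
  rw [this]
  simp [Nat.ModEq]

lemma auxCnt_perm {N n : ℕ} (x y : Fin N → Fin n) :
    auxCnt x = auxCnt y ↔ ∃ σ : Equiv.Perm (Fin N), y = x ∘ σ := by
  constructor
  · intro h
    have hc : ∀ a, Nonempty ({i // y i = a} ≃ {i // x i = a}) := by
      intro a
      rw [← Fintype.card_eq, Fintype.card_subtype, Fintype.card_subtype]
      exact (congrFun h a).symm
    refine ⟨Equiv.ofFiberEquiv fun a => (hc a).some, ?_⟩
    funext i
    exact (Equiv.ofFiberEquiv_map (fun a => (hc a).some) i).symm
  · rintro ⟨σ, rfl⟩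
    funext a
    unfold auxCnt
    refine Finset.card_bij' (fun i _ => σ.symm i) (fun i _ => σ i) ?_ ?_ ?_ ?_ <;> simp

lemma auxCnt_shift_congr {N n : ℕ} (j : ℕ) (x y : Fin N → Fin n) (h : auxCnt x = auxCnt y) :
    auxCnt (shift^[j] x) = auxCnt (shift^[j] y) := by
  obtain ⟨σ, rfl⟩ := (auxCnt_perm x y).1 h
  refine (auxCnt_perm _ _).2 ⟨σ, ?_⟩
  funext i
  ext
  rw [Function.comp_apply, aux_shift_val, aux_shift_val]
  rfl

lemma aux_shift_mod {N n : ℕ} (j : ℕ) (x : Fin N → Fin n) :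
    shift^[j % n] x = shift^[j] x := by
  funext i
  ext
  rw [aux_shift_val, aux_shift_val, Nat.add_mod_mod]

lemma aux_orbitRel_iff {m n : ℕ} (hn : 0 < n) (x y : {x : Fin (m * n) → Fin n // memC m n x}) :
    orbitRel m n x y ↔ ∃ j, auxCnt (y : Fin (m * n) → Fin n) = auxCnt (shift^[j] x.1) := by
  constructor
  · rintro ⟨j, -, σ, h⟩
    refine ⟨j, ?_⟩
    rw [h]
    exact auxCnt_shift_congr j _ _ ((auxCnt_perm _ _).2 ⟨σ, rfl⟩).symm
  · rintro ⟨j, h⟩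
    obtain ⟨σ, hσ⟩ := (auxCnt_perm _ _).1 h.symm
    refine ⟨j % n, Nat.mod_lt _ hn, σ, ?_⟩
    rw [hσ, aux_shift_mod]
    funext i
    ext
    rw [Function.comp_apply, aux_shift_val, aux_shift_val]
    rfl

lemma aux_orbitRel_equiv {m n : ℕ} (hn : 0 < n) : Equivalence (orbitRel m n) := by
  constructor
  · intro x
    exact (aux_orbitRel_iff hn x x).2 ⟨0, rfl⟩
  · intro x y h
    obtain ⟨j, h⟩ := (aux_orbitRel_iff hn x y).1 h
    refine (aux_orbitRel_iff hn y x).2 ⟨n * j - j, ?_⟩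
    rw [auxCnt_shift_congr _ _ _ h, ← Function.iterate_add_apply]
    have hj : n * j - j + j = n * j := Nat.sub_add_cancel (Nat.le_mul_of_pos_left _ hn)
    rw [hj, ← aux_shift_mod]
    simp
  · intro x y z h1 h2
    obtain ⟨j, h1⟩ := (aux_orbitRel_iff hn x y).1 h1
    obtain ⟨k, h2⟩ := (aux_orbitRel_iff hn y z).1 h2
    refine (aux_orbitRel_iff hn x z).2 ⟨k + j, ?_⟩
    rw [h2, auxCnt_shift_congr _ _ _ h1, ← Function.iterate_add_apply]

lemma aux_shift_free {m n : ℕ} (hm : 0 < m) (x : Fin (m * n) → Fin n) (hx : memC m n x)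
    (i j : ℕ) (hij : i < j) (hj : j < n) (h : auxCnt (shift^[i] x) = auxCnt (shift^[j] x)) :
    False := by
  have hn : 0 < n := by omega
  have hT := (auxCnt_mem x).2 hx
  unfold auxT at hT
  rw [Finset.mem_filter, Finset.mem_piAntidiag] at hT
  refine aux_free m n (j - i) hm (by omega) (by omega) (auxCntN x) ?_ ?_ ?_ ?_
  · intro k
    rw [auxCntN_eq hn, auxCntN_eq hn]
    simp
  · intro k
    rw [← auxCntN_shift i, auxCntN_eq hn, h, ← auxCntN_eq hn,
      show k + (j - i) + i = k + j by omega, auxCntN_shift]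
  · rw [Finset.sum_range]
    simp only [auxCntN_val]
    exact hT.1.1
  · rw [Finset.sum_range]
    simp only [auxCntN_val]
    exact hT.2

lemma auxCnt_surj {N n : ℕ} (f : Fin n → ℕ) (hf : ∑ a, f a = N) :
    ∃ x : Fin N → Fin n, auxCnt x = f := by
  have hc : Fintype.card (Fin N) = Fintype.card (Σ a, Fin (f a)) := by simp [hf]
  let e := Fintype.equivOfCardEq hc
  refine ⟨fun i => (e i).1, ?_⟩
  funext a
  unfold auxCnt
  rw [← Fintype.card_subtype, ← Fintype.card_fin (f a)]
  apply Fintype.card_congr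
  refine (e.subtypeEquiv (q := fun s => s.1 = a) (fun i => Iff.rfl)).trans ?_
  exact Equiv.sigmaSubtype a

lemma aux_card_quot (m n : ℕ) (hm : 0 < m) (hn : 0 < n) :
    n * Nat.card (Quot (orbitRel m n)) = (auxT m n).card := by
  have hq : ∀ x y, Quot.mk (orbitRel m n) x = Quot.mk _ y → orbitRel m n x y := by
    intro x y h
    exact (aux_orbitRel_equiv hn).eqvGen_iff.1 (Quot.eqvGen_exact h)
  let Φ : Fin n × Quot (orbitRel m n) → auxT m n := fun p =>
    ⟨auxCnt (shift^[(p.1 : ℕ)] (p.2.out).1),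
      (auxCnt_mem _).2 (aux_memC_shift _ _ (p.2.out).2)⟩
  have hΦ : Function.Bijective Φ := by
    constructor
    · rintro ⟨i, p⟩ ⟨j, q⟩ h
      have h' : auxCnt (shift^[(i : ℕ)] (p.out).1) = auxCnt (shift^[(j : ℕ)] (q.out).1) :=
        congrArg Subtype.val h
      have hpq : p = q := by
        rw [← Quot.out_eq p, ← Quot.out_eq q]
        let w : {x : Fin (m * n) → Fin n // memC m n x} :=
          ⟨shift^[(i : ℕ)] (p.out).1, aux_memC_shift _ _ (p.out).2⟩
        have h1 : orbitRel m n p.out w := (aux_orbitRel_iff hn _ _).2 ⟨i, rfl⟩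
        have h2 : orbitRel m n q.out w := (aux_orbitRel_iff hn _ _).2 ⟨j, h'⟩
        exact (Quot.sound h1).trans (Quot.sound h2).symm
      subst hpq
      rcases lt_trichotomy i j with hlt | heq | hlt
      · exact (aux_shift_free hm _ (p.out).2 i j hlt j.isLt h').elim
      · rw [heq]
      · exact (aux_shift_free hm _ (p.out).2 j i hlt i.isLt h'.symm).elim
    · rintro ⟨f, hf⟩
      have hf' := hf
      unfold auxT at hf'
      rw [Finset.mem_filter, Finset.mem_piAntidiag] at hf'
      obtain ⟨x, rfl⟩ := auxCnt_surj f hf'.1.1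
      let x' : {x : Fin (m * n) → Fin n // memC m n x} := ⟨x, (auxCnt_mem x).1 hf⟩
      obtain ⟨j, hj⟩ := (aux_orbitRel_iff hn _ _).1
        (hq (Quot.mk (orbitRel m n) x').out x' (Quot.out_eq _))
      refine ⟨(⟨j % n, Nat.mod_lt _ hn⟩, Quot.mk (orbitRel m n) x'), ?_⟩
      apply Subtype.ext
      change auxCnt (shift^[j % n] _) = auxCnt x
      rw [aux_shift_mod]
      exact hj.symm
  have := Nat.card_eq_of_bijective Φ hΦ
  rw [Nat.card_prod, Nat.card_fin] at this
  rw [this]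
  simp

/-- If `K` is the number of equivalence classes of `C_{m,n}` under simultaneous shifts
and coordinate permutations, then
`n² K = ∑_{d ∣ n} (-1)^{m(n+d)} μ(n/d) C((m+1)d - 1, md)`. -/
theorem n_sq_mul_card_classes (m n : ℕ) (hm : 0 < m) (hn : 0 < n) :
    ((n : ℤ) ^ 2) * Nat.card (Quot (orbitRel m n)) =
      ∑ d ∈ n.divisors, (-1 : ℤ) ^ (m * (n + d)) *
        ArithmeticFunction.moebius (n / d) * ((m + 1) * d - 1).choose (m * d) := by
  rw [← aux_T_card m n hm hn, ← aux_card_quot m n hm hn]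
  push_cast
  ring
end

section
/- Let n ≥ 2 and let x = (x_1,…,x_n) be a tuple with each x_i ∈ {0,…,n−1} and x_1 + ⋯ + x_n ≡ (n−1)(n−2)/2 (mod n). Then there exists exactly one j ∈ {0, 1, …, n−1} such that shift^j(x) is a lattice point of the permutahedron P_{δ_n}, i.e., such that shift^j(x), regarded as a point of ℝ^n, lies in the convex hull of the coordinate permutations of δ_n. -/
/-- The tuple `δ_n = (n-2, n-3, …, 1, 0, 0)`: its `i`-th coordinate (0-indexed) is
`n - 2 - i` (natural subtraction). -/
def deltaTuple (n : ℕ) : Fin n → ℕ := fun i => n - 2 - (i : ℕ)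

/-- The vertices of the permutahedron `P_{δ_n}`: all coordinate permutations of `δ_n`,
viewed as points of `ℝⁿ`. -/
def permutahedronVerts (n : ℕ) : Set (Fin n → ℝ) :=
  {y | ∃ σ : Equiv.Perm (Fin n), y = fun i => (deltaTuple n (σ i) : ℝ)}

/-- The lattice points of `P_{δ_n}`: integer points whose real image lies in the convex
hull of the coordinate permutations of `δ_n`. -/
def latticePts (n : ℕ) : Set (Fin n → ℤ) :=
  {x | (fun i => (x i : ℝ)) ∈ convexHull ℝ (permutahedronVerts n)}

/-- The shift map: add `1` to every coordinate and reduce modulo `n` so as to lie in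
`{0,…,n-1}`. -/
def shiftMod (n : ℕ) {N : ℕ} (x : Fin N → ℕ) : Fin N → ℕ :=
  fun i => (x i + 1) % n

/-- Sum of positive parts. -/
def Gs {n : ℕ} (x : Fin n → ℤ) (t : ℤ) : ℤ := ∑ i, max (t - x i) 0

def dz (n : ℕ) : Fin n → ℤ := fun i => (deltaTuple n i : ℤ)

def tri (q : ℤ) : ℤ := q * (q + 1) / 2

theorem two_tri (q : ℤ) : 2 * tri q = q * (q + 1) :=
  Int.mul_ediv_cancel' (Int.even_mul_succ_self q).two_dvd

theorem tri_add (a b : ℤ) : tri (a + b) = tri a + tri b + a * b := by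
  have h1 := two_tri (a + b)
  have h2 := two_tri a
  have h3 := two_tri b
  linarith

def phi (n : ℤ) (u : ℤ) : ℤ := (u / n + 1) * u - n * tri (u / n)

theorem phi_add (n : ℤ) (hn : 0 < n) (w k : ℤ) :
    phi n (w + n * k) = phi n w + k * w + n * tri k := by
  unfold phi
  rw [Int.add_mul_ediv_left _ _ hn.ne', tri_add]
  linear_combination (-n) * two_tri k

theorem phi_small (n : ℤ) (hn : 0 < n) (w : ℤ) (h1 : -n ≤ w) (h2 : w ≤ n) :
    phi n w = max w 0 := by
  have base : ∀ w, 0 ≤ w → w < n → phi n w = w := by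
    intro w h h'
    unfold phi
    rw [Int.ediv_eq_zero_of_lt h h']
    simp [tri]
  rcases lt_or_ge w 0 with h | h
  · have := phi_add n hn (w + n) (-1)
    rw [base (w + n) (by omega) (by omega)] at this
    have e : w + n + n * (-1) = w := by ring
    rw [e] at this
    rw [this, max_eq_right h.le]
    simp [tri]
  · rcases lt_or_eq_of_le h2 with h' | h'
    · rw [base w h h', max_eq_left h]
    · have := phi_add n hn 0 1
      rw [base 0 le_rfl hn] at this
      rw [max_eq_left h, h']
      simpa [tri] using this

theorem phi_convex (n : ℤ) (hn : 0 < n) (u : ℤ) :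
    2 * phi n u ≤ phi n (u + 1) + phi n (u - 1) := by
  have hd := Int.emod_add_mul_ediv u n
  have h0 := Int.emod_nonneg u hn.ne'
  have h1 := Int.emod_lt_of_pos u hn
  generalize u % n = r at *
  generalize u / n = q at *
  subst hd
  rw [show r + n * q + 1 = (r + 1) + n * q by ring, show r + n * q - 1 = (r - 1) + n * q by ring,
    phi_add n hn, phi_add n hn, phi_add n hn, phi_small n hn r (by omega) (by omega),
    phi_small n hn (r + 1) (by omega) (by omega), phi_small n hn (r - 1) (by omega) (by omega)]
  have : 2 * max r 0 ≤ max (r + 1) 0 + max (r - 1) 0 := by omega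
  nlinarith

/-- Cycle lemma: existence. -/
theorem cycle_exists (n : ℤ) (hn : 2 ≤ n) (K : ℤ → ℤ) (hK : ∀ m, K (m + n) = K m - 1)
    (hc : ∀ m, 2 * K m - 1 ≤ K (m + 1) + K (m - 1)) :
    ∃ p, K (p - 1) = K p + 1 ∧ ∀ t, 0 ≤ t → K (p + t) ≤ K p := by
  have hper : ∀ (k : ℤ) m, K (m + n * k) = K m - k := by
    intro k
    induction k using Int.induction_on with
    | zero => simp
    | succ k ih =>
      intro m
      rw [show m + n * ((k : ℤ) + 1) = (m + n * k) + n by ring, hK, ih]; ring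
    | pred k ih =>
      intro m
      have := hK (m + n * (-(k : ℤ) - 1))
      rw [show m + n * (-(k : ℤ) - 1) + n = m + n * (-k) by ring, ih] at this
      linarith
  obtain ⟨q, -, hq⟩ := Finset.exists_max_image (Finset.Ico 0 n) (fun m => n * K m + m)
    ⟨0, by simp; omega⟩
  have hq' : ∀ m, n * K m + m ≤ n * K q + q := by
    intro m
    have h := hq (m % n) (by
      simp [Int.emod_nonneg m (by omega : n ≠ 0), Int.emod_lt_of_pos m (by omega : 0 < n)])
    have hd := Int.emod_add_mul_ediv m n
    have h2 := hper (m / n) (m % n)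
    rw [hd] at h2
    have h3 : n * K m = n * K (m % n) - n * (m / n) := by rw [h2]; ring
    linarith
  have hgt : ∀ m, q < m → K m ≤ K q - 1 := by
    intro m hm
    by_contra hcon
    have := hq' m
    nlinarith
  have hge : ∀ m, q - n < m → K m ≤ K q := by
    intro m hm
    have := hgt (m + n) (by omega)
    rw [hK] at this
    linarith
  have e1 := hK (q - n)
  rw [sub_add_cancel] at e1
  have e2 := hK (q - n + 1)
  rw [show q - n + 1 + n = q + 1 by ring] at e2
  have e3 := hge (q - n + 1) (by omega)
  have e4 := hc q
  have e5 := hge (q - 1) (by omega)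
  have e6 := hgt (q + 1) (by omega)
  have e7 : K (q - n + 1) = K q := by omega
  refine ⟨q - n + 1, ?_, ?_⟩
  · rw [add_sub_cancel_right, e7]; omega
  · intro t ht
    rw [e7]
    exact hge _ (by omega)

theorem cycle_unique (n : ℤ) (K : ℤ → ℤ) (hK : ∀ m, K (m + n) = K m - 1) (p p' : ℤ)
    (h : K (p - 1) = K p + 1) (ht : ∀ t, 0 ≤ t → t ≤ n - 1 → K (p + t) ≤ K p)
    (h' : K (p' - 1) = K p' + 1) (ht' : ∀ t, 0 ≤ t → t ≤ n - 1 → K (p' + t) ≤ K p')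
    (h1 : p < p') (h2 : p' < p + n) : False := by
  have a1 := ht (p' - p) (by omega) (by omega)
  have a2 := ht (p' - 1 - p) (by omega) (by omega)
  have a3 := ht' (p + n - 1 - p') (by omega) (by omega)
  have a4 := hK (p - 1)
  rw [show p + (p' - p) = p' by ring] at a1
  rw [show p + (p' - 1 - p) = p' - 1 by ring] at a2
  rw [show p' + (p + n - 1 - p') = p - 1 + n by ring] at a3
  omega

theorem dz_succ (n : ℕ) (hn : 1 ≤ n) : (dz (n+1) 0 = n - 1) ∧ ∀ i : Fin n, dz (n+1) i.succ = dz n i := by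
  constructor
  · simp [dz, deltaTuple]; omega
  · intro i; simp [dz, deltaTuple]; omega

theorem dz_sum (n : ℕ) (hn : 1 ≤ n) : ∑ i, dz n i = tri (n - 2) := by
  induction n, hn using Nat.le_induction with
  | base => simp [dz, deltaTuple, tri]
  | succ n hn ih =>
    rw [Fin.sum_univ_succ, (dz_succ n hn).1]
    simp only [(dz_succ n hn).2]
    rw [ih]
    have := tri_add (n - 2) 1
    have h2 : tri 1 = 1 := by decide
    push_cast
    rw [show (n : ℤ) + 1 - 2 = n - 2 + 1 by ring]
    linarith

theorem dz_nonneg (n : ℕ) (i : Fin n) : 0 ≤ dz n i := by simp [dz]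

theorem dz_le (n : ℕ) (hn : 2 ≤ n) (i : Fin n) : dz n i ≤ n - 2 := by
  simp [dz, deltaTuple]; omega

theorem Gs_large {n : ℕ} (x : Fin n → ℤ) (t : ℤ) (h : ∀ i, x i ≤ t) :
    Gs x t = n * t - ∑ i, x i := by
  unfold Gs
  rw [Finset.sum_congr rfl (fun i _ => max_eq_left (sub_nonneg.2 (h i)))]
  simp

theorem Gs_small {n : ℕ} (x : Fin n → ℤ) (t : ℤ) (h : ∀ i, t ≤ x i) :
    Gs x t = 0 := by
  unfold Gs
  exact Finset.sum_eq_zero (fun i _ => max_eq_right (sub_nonpos.2 (h i)))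

theorem Gs_ge {n : ℕ} (x : Fin n → ℤ) (t : ℤ) :
    n * t - ∑ i, x i ≤ Gs x t := by
  have : ∑ i, (t - x i) ≤ Gs x t := Finset.sum_le_sum (fun i _ => le_max_left _ _)
  simpa using this

theorem Gs_nonneg {n : ℕ} (x : Fin n → ℤ) (t : ℤ) : 0 ≤ Gs x t :=
  Finset.sum_nonneg (fun _ _ => le_max_right _ _)

theorem Gs_dz (n : ℕ) (hn : 2 ≤ n) : ∀ t : ℤ, 0 ≤ t → t ≤ n - 1 → Gs (dz n) t = tri t + t := by
  induction n, hn using Nat.le_induction with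
  | base =>
    intro t h0 h1
    have : t = 0 ∨ t = 1 := by push_cast at h1; omega
    rcases this with rfl | rfl <;> decide
  | succ n hn ih =>
    intro t h0 h1
    push_cast at h1
    rcases lt_or_eq_of_le h1 with h | h
    · unfold Gs
      rw [Fin.sum_univ_succ, (dz_succ n (by omega)).1]
      simp only [(dz_succ n (by omega : 1 ≤ n)).2]
      rw [← ih t h0 (by omega), max_eq_right (by omega), zero_add]
      rfl
    · rw [Gs_large _ _ (fun i => by have := dz_le (n+1) (by omega) i; push_cast at this; omega), dz_sum _ (by omega)]
      have ht : t = n := by omega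
      subst ht
      push_cast
      have := two_tri n
      have := two_tri ((n:ℤ) + 1 - 2)
      linarith

theorem Gs_second {n : ℕ} (x : Fin n → ℤ) (t : ℤ) :
    Gs x (t + 1) + Gs x (t - 1) - 2 * Gs x t = (Finset.univ.filter (fun i => x i = t)).card := by
  unfold Gs
  rw [Finset.card_filter, Finset.mul_sum, ← Finset.sum_add_distrib, ← Finset.sum_sub_distrib]
  push_cast
  refine Finset.sum_congr rfl (fun i _ => ?_)
  split_ifs <;> omega

theorem Gs_move {n : ℕ} (x : Fin n → ℤ) (t s : ℤ) (i j : Fin n) (hij : i ≠ j)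
    (hi : x i = t) (hj : x j = t) :
    Gs (x + Pi.single i 1 - Pi.single j 1) s = Gs x s + if s = t then 1 else 0 := by
  have : ∀ k, max (s - (x + Pi.single i 1 - Pi.single j 1 : Fin n → ℤ) k) 0 = max (s - x k) 0 +
      ((if k = i then max (s - t - 1) 0 - max (s - t) 0 else 0) +
       (if k = j then max (s - t + 1) 0 - max (s - t) 0 else 0)) := by
    intro k
    simp only [Pi.sub_apply, Pi.add_apply, Pi.single_apply]
    by_cases h1 : k = i
    · subst h1
      simp only [hij, if_true, if_false, hi]
      rw [show s - (t + 1 - 0) = s - t - 1 by ring]; ring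
    · by_cases h2 : k = j
      · subst h2
        simp only [h1, if_true, if_false, hj]
        rw [show s - (t + 0 - 1) = s - t + 1 by ring]; ring
      · simp [h1, h2]
  unfold Gs
  rw [Finset.sum_congr rfl (fun k _ => this k), Finset.sum_add_distrib, Finset.sum_add_distrib]
  simp only [Finset.sum_ite_eq', Finset.mem_univ, if_true]
  split_ifs <;> omega

theorem hull_of_le (n : ℕ) (hn : 2 ≤ n) (N : ℕ) : ∀ x : Fin n → ℤ, ∑ i, x i = ∑ i, dz n i →
    (∀ t, Gs x t ≤ Gs (dz n) t) →
    ∑ t ∈ Finset.Icc (0:ℤ) n, (Gs (dz n) t - Gs x t) < N →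
    x ∈ latticePts n := by
  induction N with
  | zero =>
    intro x _ hG h
    have : 0 ≤ ∑ t ∈ Finset.Icc (0:ℤ) n, (Gs (dz n) t - Gs x t) :=
      Finset.sum_nonneg (fun t _ => sub_nonneg.2 (hG t))
    push_cast at h
    omega
  | succ N ih =>
    intro x hs hG hN
    have hlow : ∀ t ≤ 0, Gs x t = Gs (dz n) t := by
      intro t ht
      have := hG t
      have h1 := Gs_nonneg x t
      rw [Gs_small (dz n) t (fun i => ht.trans (dz_nonneg n i))] at *
      omega
    have hhigh : ∀ t : ℤ, n - 2 ≤ t → Gs x t = Gs (dz n) t := by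
      intro t ht
      have := hG t
      have h1 := Gs_ge x t
      rw [Gs_large (dz n) t (fun i => (dz_le n hn i).trans ht)] at *
      omega
    by_cases hall : ∀ t, Gs x t = Gs (dz n) t
    · have hcard : ∀ t, (Finset.univ.filter (fun i => x i = t)).card =
          (Finset.univ.filter (fun i => dz n i = t)).card := by
        intro t
        have h1 := Gs_second x t
        have h2 := Gs_second (dz n) t
        simp only [hall] at h1
        omega
      have hex : ∀ t, Nonempty ({i // x i = t} ≃ {i // dz n i = t}) := by
        intro t
        refine ⟨Fintype.equivOfCardEq ?_⟩
        rw [Fintype.card_subtype, Fintype.card_subtype]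
        exact hcard t
      let σ : Equiv.Perm (Fin n) := Equiv.ofFiberEquiv (fun t => (hex t).some)
      have hσ : ∀ i, dz n (σ i) = x i := fun i => Equiv.ofFiberEquiv_map _ i
      apply subset_convexHull
      refine ⟨σ, ?_⟩
      funext i
      have : x i = dz n (σ i) := (hσ i).symm
      simp [this, dz]
    · push Not at hall
      obtain ⟨t0, ht0⟩ := hall
      have ht0a : 0 < t0 := by by_contra h; exact ht0 (hlow _ (by omega))
      have ht0b : t0 < n - 2 := by by_contra h; exact ht0 (hhigh _ (by omega))
      have ht0c := lt_of_le_of_ne (hG t0) ht0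
      obtain ⟨t, htm, ht⟩ := Finset.exists_min_image (Finset.Icc (0:ℤ) n)
        (fun t => (n + 1) * (Gs x t - Gs (dz n) t) + t) ⟨t0, by simp; omega⟩
      rw [Finset.mem_Icc] at htm
      have key := ht t0 (by simp; omega)
      have hneg : Gs x t - Gs (dz n) t < 0 := by
        by_contra hc
        nlinarith
      have hta : 0 < t := by
        by_contra h
        have := hlow t (by omega)
        omega
      have htb : t < n - 2 := by
        by_contra h
        have := hhigh t (by omega)
        omega
      have k1 := ht (t - 1) (by simp; omega)
      have k2 := ht (t + 1) (by simp; omega)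
      have d1 : Gs x t - Gs (dz n) t < Gs x (t - 1) - Gs (dz n) (t - 1) := by
        by_contra hc
        nlinarith
      have d2 : Gs x t - Gs (dz n) t ≤ Gs x (t + 1) - Gs (dz n) (t + 1) := by
        by_contra hc
        nlinarith
      have s1 := Gs_second x t
      have s2 := Gs_second (dz n) t
      have hpos : 0 < (Finset.univ.filter (fun i => dz n i = t)).card := by
        rw [Finset.card_pos]
        refine ⟨⟨(n - 2 - t).toNat, by omega⟩, Finset.mem_filter.2 ⟨Finset.mem_univ _, ?_⟩⟩
        simp only [dz, deltaTuple]
        omega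
      have h2 : 1 < (Finset.univ.filter (fun i => x i = t)).card := by omega
      obtain ⟨i, hi, j, hj, hij⟩ := Finset.one_lt_card.1 h2
      have hi' : x i = t := by simpa using hi
      have hj' : x j = t := by simpa using hj
      have main : ∀ i j, i ≠ j → x i = t → x j = t →
          (x + Pi.single i 1 - Pi.single j 1) ∈ latticePts n := by
        intro i j hij hi hj
        apply ih
        · rw [← hs]
          simp [Finset.sum_add_distrib, Finset.sum_sub_distrib]
        · intro s
          rw [Gs_move x t s i j hij hi hj]
          split_ifs with h
          · subst h; omega
          · simpa using hG s
        · simp only [Gs_move x t _ i j hij hi hj]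
          have : ∀ s, Gs (dz n) s - (Gs x s + if s = t then 1 else 0) =
            (Gs (dz n) s - Gs x s) - if s = t then 1 else 0 := fun s => by ring
          simp only [this]
          rw [Finset.sum_sub_distrib, Finset.sum_ite_eq', if_pos (by simp; omega)]
          push_cast at hN
          omega
      have m1 := main i j hij hi' hj'
      have m2 := main j i hij.symm hj' hi'
      unfold latticePts at m1 m2 ⊢
      rw [Set.mem_ofPred_eq] at m1 m2 ⊢
      have := convex_convexHull ℝ (permutahedronVerts n) m1 m2 (a := 1/2) (b := 1/2)
        (by norm_num) (by norm_num) (by norm_num)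
      convert this using 1
      funext k
      simp only [Pi.add_apply, Pi.smul_apply, Pi.sub_apply, smul_eq_mul]
      push_cast
      ring

theorem lattice_iff (n : ℕ) (hn : 2 ≤ n) (x : Fin n → ℤ) :
    x ∈ latticePts n ↔ ∑ i, x i = ∑ i, dz n i ∧ ∀ t, Gs x t ≤ Gs (dz n) t := by
  constructor
  · intro h
    have hsub : convexHull ℝ (permutahedronVerts n) ⊆
        {z : Fin n → ℝ | ∑ i, z i = ((∑ i, dz n i : ℤ) : ℝ) ∧
          ∀ t : ℤ, ∑ i, max ((t : ℝ) - z i) 0 ≤ (Gs (dz n) t : ℝ)} := by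
      apply convexHull_min
      · rintro y ⟨σ, rfl⟩
        constructor
        · have := Equiv.sum_comp σ (fun i => (deltaTuple n i : ℝ))
          rw [this]; simp [dz]
        · intro t
          have := Equiv.sum_comp σ (fun i => max ((t : ℝ) - (deltaTuple n i : ℝ)) 0)
          rw [this]; simp [Gs, dz]
      · rintro y ⟨hy1, hy2⟩ z ⟨hz1, hz2⟩ a b ha hb hab
        constructor
        · simp only [Pi.add_apply, Pi.smul_apply, smul_eq_mul]
          rw [Finset.sum_add_distrib, ← Finset.mul_sum, ← Finset.mul_sum, hy1, hz1, ← add_mul, hab,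
            one_mul]
        · intro t
          have e : ∀ i, max ((t : ℝ) - (a • y + b • z) i) 0 ≤
              a * max ((t : ℝ) - y i) 0 + b * max ((t : ℝ) - z i) 0 := by
            intro i
            simp only [Pi.add_apply, Pi.smul_apply, smul_eq_mul]
            have h1 := mul_le_mul_of_nonneg_left (le_max_left ((t : ℝ) - y i) 0) ha
            have h2 := mul_le_mul_of_nonneg_left (le_max_left ((t : ℝ) - z i) 0) hb
            apply max_le
            · have : (t : ℝ) = a * t + b * t := by rw [← add_mul, hab, one_mul]
              linarith
            · positivity
          refine (Finset.sum_le_sum (fun i _ => e i)).trans ?_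
          rw [Finset.sum_add_distrib, ← Finset.mul_sum, ← Finset.mul_sum]
          have h1 := mul_le_mul_of_nonneg_left (hy2 t) ha
          have h2 := mul_le_mul_of_nonneg_left (hz2 t) hb
          have : (Gs (dz n) t : ℝ) = a * Gs (dz n) t + b * Gs (dz n) t := by
            rw [← add_mul, hab, one_mul]
          linarith
    obtain ⟨h1, h2⟩ := hsub h
    constructor
    · simp only at h1
      exact_mod_cast h1
    · intro t
      have := h2 t
      have e : ((Gs x t : ℤ) : ℝ) = ∑ i, max ((t : ℝ) - (x i : ℝ)) 0 := by simp [Gs]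
      rw [← e] at this
      exact_mod_cast this
  · rintro ⟨h1, h2⟩
    refine hull_of_le n hn ((∑ t ∈ Finset.Icc (0:ℤ) n, (Gs (dz n) t - Gs x t)).toNat + 1) x h1 h2 ?_
    push_cast
    have := Int.self_le_toNat (∑ t ∈ Finset.Icc (0:ℤ) n, (Gs (dz n) t - Gs x t))
    omega

theorem shift_iter (n : ℕ) (x : Fin n → ℕ) (hx : ∀ i, x i < n) (j : ℕ) (i : Fin n) :
    (shiftMod n)^[j] x i = (x i + j) % n := by
  induction j with
  | zero => simp [Nat.mod_eq_of_lt (hx i)]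
  | succ j ih =>
    rw [Function.iterate_succ_apply']
    simp only [shiftMod]
    rw [ih, Nat.mod_add_mod, add_assoc]

def Kf {n : ℕ} (x : Fin n → ℕ) (a : ℤ) (m : ℤ) : ℤ :=
  ∑ i, phi n (m - x i) - tri m - (a + 1) * m

theorem mem_iff (n : ℕ) (hn : 2 ≤ n) (x : Fin n → ℕ) (hx : ∀ i, x i < n) (a : ℤ)
    (ha : n * a = tri (n - 2) - ∑ i, (x i : ℤ)) (j : ℕ) :
    (fun i => (((shiftMod n)^[j] x i : ℕ) : ℤ)) ∈ latticePts n ↔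
      Kf x a (-j - 1) = Kf x a (-j) + 1 ∧
        ∀ t : ℤ, 0 ≤ t → t ≤ n - 1 → Kf x a (-j + t) ≤ Kf x a (-j) := by
  have hn0 : (0:ℤ) < n := by omega
  simp only [shift_iter n x hx]
  set y : Fin n → ℤ := fun i => (((x i + j) % n : ℕ) : ℤ) with hy
  set e : Fin n → ℤ := fun i => ((x i : ℤ) + j) / n with he
  have hye : ∀ i, (x i : ℤ) + j = y i + n * e i := by
    intro i
    have := Int.emod_add_mul_ediv ((x i : ℤ) + j) n
    simp only [hy, he]
    push_cast
    linarith
  have hy0 : ∀ i, 0 ≤ y i := fun i => by simp only [hy]; positivity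
  have hyn : ∀ i, y i ≤ n - 1 := fun i => by
    have : (x i + j) % n < n := Nat.mod_lt _ (by omega)
    simp only [hy]; omega
  have hphi : ∀ i (t : ℤ), -1 ≤ t → t ≤ n → phi n (-j + t - x i) =
      max (t - y i) 0 - e i * (t - y i) + n * tri (-e i) := by
    intro i t h1 h2
    have h3 := hy0 i
    have h4 := hyn i
    rw [show -(j:ℤ) + t - x i = (t - y i) + n * (-e i) by linarith [hye i], phi_add n hn0,
      phi_small n hn0 _ (by omega) (by omega)]
    ring
  have hsumphi : ∀ t : ℤ, -1 ≤ t → t ≤ n → ∑ i, phi n (-j + t - x i) =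
      Gs y t - t * ∑ i, e i + ∑ i, (e i * y i + n * tri (-e i)) := by
    intro t h1 h2
    rw [Finset.sum_congr rfl (fun i _ => hphi i t h1 h2)]
    unfold Gs
    rw [Finset.mul_sum, ← Finset.sum_sub_distrib, ← Finset.sum_add_distrib]
    exact Finset.sum_congr rfl (fun i _ => by ring)
  have hK : ∀ t : ℤ, -1 ≤ t → t ≤ n → Kf x a (-j + t) - Kf x a (-j) =
      Gs y t - t * ∑ i, e i - tri t + j * t - (a + 1) * t := by
    intro t h1 h2
    have g1 := hsumphi t h1 h2
    have g2 := hsumphi 0 (by omega) (by omega)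
    rw [Gs_small y 0 hy0] at g2
    rw [add_zero] at g2
    unfold Kf
    rw [g1, g2, tri_add]
    ring
  have hysum : ∑ i, y i = ∑ i, (x i : ℤ) + n * j - n * ∑ i, e i := by
    have : ∑ i, ((x i : ℤ) + j) = ∑ i, (y i + n * e i) :=
      Finset.sum_congr rfl (fun i _ => hye i)
    rw [Finset.sum_add_distrib, Finset.sum_add_distrib, ← Finset.mul_sum] at this
    simp at this
    linarith
  have hm1 := hK (-1) le_rfl (by omega)
  rw [Gs_small y (-1) (fun i => by have := hy0 i; omega), show tri (-1) = 0 by decide,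
    ← sub_eq_add_neg] at hm1
  have hsum_iff : (∑ i, y i = ∑ i, dz n i) ↔ Kf x a (-j - 1) = Kf x a (-j) + 1 := by
    rw [dz_sum n (by omega), hysum]
    constructor
    · intro h
      have : (n:ℤ) * (j - ∑ i, e i - a) = 0 := by linarith
      have := (mul_eq_zero.1 this).resolve_left hn0.ne'
      linarith
    · intro h
      have : j - ∑ i, e i - a = 0 := by linarith
      have : (n:ℤ) * (j - ∑ i, e i - a) = 0 := by rw [this, mul_zero]
      linarith
  rw [lattice_iff n hn, hsum_iff]
  refine and_congr_right (fun hp => ?_)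
  have hs := hsum_iff.2 hp
  have hE : ∑ i, e i = j - a := by linarith
  have hK2 : ∀ t : ℤ, 0 ≤ t → t ≤ n - 1 → Kf x a (-j + t) - Kf x a (-j) =
      Gs y t - Gs (dz n) t := by
    intro t h1 h2
    rw [hK t (by omega) (by omega), Gs_dz n hn t h1 h2, hE]
    ring
  constructor
  · intro h t h1 h2
    have := hK2 t h1 h2
    have := h t
    omega
  · intro h t
    rcases lt_or_ge t 0 with h0 | h0
    · rw [Gs_small y t (fun i => h0.le.trans (hy0 i))]
      exact Gs_nonneg _ _
    · rcases le_or_gt t (n - 1) with h1 | h1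
      · have := hK2 t h0 h1
        have := h t h0 h1
        omega
      · rw [Gs_large y t (fun i => (hyn i).trans h1.le), hs]
        exact Gs_ge _ _

/-- If `x` is a tuple with entries in `{0,…,n-1}` and coordinate sum
`≡ (n-1)(n-2)/2 (mod n)`, then there is exactly one `j ∈ {0,…,n-1}` such that
`shiftʲ(x)` is a lattice point of the permutahedron `P_{δ_n}`. -/
theorem unique_shift_in_permutahedron (n : ℕ) (hn : 2 ≤ n) (x : Fin n → ℕ)
    (hx : ∀ i, x i < n)
    (hsum : ((∑ i, x i : ℕ) : ZMod n) = (((n - 1) * (n - 2) / 2 : ℕ) : ZMod n)) :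
    ∃! j : ℕ, j < n ∧
      (fun i => (((shiftMod n)^[j] x i : ℕ) : ℤ)) ∈ latticePts n := by
  have hn0 : (0:ℤ) < n := by omega
  have htri : (((n - 1) * (n - 2) / 2 : ℕ) : ℤ) = tri (n - 2) := by
    obtain ⟨k, rfl⟩ := Nat.exists_eq_add_of_le hn
    unfold tri
    rw [show 2 + k - 1 = k + 1 by omega, show 2 + k - 2 = k by omega]
    push_cast
    rw [show (2:ℤ) + k - 2 = k by ring, mul_comm]
  obtain ⟨a, ha⟩ : ∃ a : ℤ, n * a = tri (n - 2) - ∑ i, (x i : ℤ) := by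
    have h1 : (((∑ i, x i : ℕ) : ℤ) : ZMod n) = ((((n - 1) * (n - 2) / 2 : ℕ) : ℤ) : ZMod n) := by
      rw [Int.cast_natCast, Int.cast_natCast]; exact hsum
    have h2 := (ZMod.intCast_eq_intCast_iff_dvd_sub _ _ n).1 h1
    obtain ⟨a, ha⟩ := h2
    refine ⟨a, ?_⟩
    rw [← ha, htri]
    push_cast
    ring
  have hper : ∀ m, Kf x a (m + n) = Kf x a m - 1 := by
    intro m
    have h1 : ∑ i, phi n (m + n - x i) = ∑ i, (phi n (m - x i) + ((m + n) - x i)) := by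
      refine Finset.sum_congr rfl (fun i _ => ?_)
      have := phi_add n hn0 (m - x i) 1
      rw [show m - x i + (n:ℤ) * 1 = m + n - x i by ring, show tri 1 = 1 by decide] at this
      rw [this]; ring
    rw [Finset.sum_add_distrib, Finset.sum_sub_distrib] at h1
    simp only [Finset.sum_const, Finset.card_univ, Fintype.card_fin, nsmul_eq_mul] at h1
    unfold Kf
    rw [h1, tri_add]
    have t1 := two_tri n
    have t2 := two_tri ((n:ℤ) - 2)
    linarith
  have hc : ∀ m, 2 * Kf x a m - 1 ≤ Kf x a (m + 1) + Kf x a (m - 1) := by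
    intro m
    have h1 : 2 * ∑ i, phi n (m - x i) ≤ ∑ i, phi n (m + 1 - x i) + ∑ i, phi n (m - 1 - x i) := by
      rw [Finset.mul_sum, ← Finset.sum_add_distrib]
      refine Finset.sum_le_sum (fun i _ => ?_)
      have := phi_convex n hn0 (m - x i)
      rwa [show m - x i + 1 = m + 1 - x i by ring, show m - x i - 1 = m - 1 - (x i : ℤ) by ring]
        at this
    unfold Kf
    have t1 := two_tri m
    have t2 := two_tri (m + 1)
    have t3 := two_tri (m - 1)
    linarith
  have hperk : ∀ (k : ℕ) m, Kf x a (m + n * k) = Kf x a m - k ∧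
      Kf x a (m - n * k) = Kf x a m + k := by
    intro k
    induction k with
    | zero => simp
    | succ k ih =>
      intro m
      constructor
      · have := hper (m + n * k)
        rw [(ih m).1] at this
        push_cast
        rw [show m + (n:ℤ) * (k + 1) = m + n * k + n by ring, this]; ring
      · have := hper (m - n * (k + 1))
        rw [show m - (n:ℤ) * (k + 1) + n = m - n * k by ring, (ih m).2] at this
        push_cast
        linarith
  have hperz : ∀ (k : ℤ) m, Kf x a (m + n * k) = Kf x a m - k := by
    intro k m
    obtain ⟨l, rfl | rfl⟩ := Int.eq_nat_or_neg k
    · exact (hperk l m).1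
    · have := (hperk l m).2
      rw [show m + (n:ℤ) * (-l) = m - n * l by ring, this]; ring
  obtain ⟨p, hp1, hp2⟩ := cycle_exists n (by omega) (Kf x a) hper hc
  have hd := Int.emod_add_mul_ediv (-p) n
  have hr0 := Int.emod_nonneg (-p) hn0.ne'
  have hr1 := Int.emod_lt_of_pos (-p) hn0
  obtain ⟨j, hj⟩ := Int.eq_ofNat_of_zero_le hr0
  rw [hj] at hd hr1
  refine ⟨j, ⟨by omega, ?_⟩, ?_⟩
  · rw [mem_iff n hn x hx a ha]
    have hpj : -(j:ℤ) = p + n * (-p / n) := by linarith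
    rw [hpj]
    constructor
    · rw [show p + (n:ℤ) * (-p / n) - 1 = p - 1 + n * (-p / n) by ring, hperz, hperz]
      omega
    · intro t ht _
      rw [show p + (n:ℤ) * (-p / n) + t = p + t + n * (-p / n) by ring, hperz, hperz]
      have := hp2 t ht
      omega
  · rintro j' ⟨hj'n, hj'⟩
    have hjm : (fun i => (((shiftMod n)^[j] x i : ℕ) : ℤ)) ∈ latticePts n := by
      rw [mem_iff n hn x hx a ha]
      have hpj : -(j:ℤ) = p + n * (-p / n) := by linarith
      rw [hpj]
      constructor
      · rw [show p + (n:ℤ) * (-p / n) - 1 = p - 1 + n * (-p / n) by ring, hperz, hperz]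
        omega
      · intro t ht _
        rw [show p + (n:ℤ) * (-p / n) + t = p + t + n * (-p / n) by ring, hperz, hperz]
        have := hp2 t ht
        omega
    rw [mem_iff n hn x hx a ha] at hjm hj'
    rcases lt_trichotomy j' j with h | h | h
    · exact (cycle_unique n (Kf x a) hper (-j) (-j') hjm.1 hjm.2 hj'.1 hj'.2 (by omega)
        (by omega)).elim
    · exact h
    · exact (cycle_unique n (Kf x a) hper (-j') (-j) hj'.1 hj'.2 hjm.1 hjm.2 (by omega)
        (by omega)).elim
end

section
/- Let n ≥ 2 and let σ be a permutation of {1,…,n}. Let ℓ be the number of cycles of σ on {1,…,n} (counting fixed points as cycles of length 1), and let d be the greatest common divisor of the lengths of these cycles. Define f(d) = 1 if d = 1; f(d) = 2 if d = 2 and n ≡ 2 (mod 4); and f(d) = 0 otherwise. Then n² · |{x ∈ Lat(P_{δ_n}) : x_{σ(i)} = x_i for all i}| = f(d) · n^ℓ. -/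
/-- The number of cycles of a permutation of `Fin n`, counting fixed points as cycles
of length 1. -/
def numCycles {n : ℕ} (σ : Equiv.Perm (Fin n)) : ℕ :=
  σ.cycleType.card + (Finset.univ.filter fun i => σ i = i).card

/-- The gcd of the lengths of the cycles of a permutation of `Fin n` (counting fixed
points as cycles of length 1); the cycle length of `i` is the minimal period of `σ`
at `i`. -/
noncomputable def cycleGcd {n : ℕ} (σ : Equiv.Perm (Fin n)) : ℕ :=
  Finset.univ.gcd fun i : Fin n => Function.minimalPeriod (⇑σ) i

/-- The value `f(d)` from Corollary `lattice_points_fixed`. -/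
def fVal (n d : ℕ) : ℕ :=
  if d = 1 then 1 else if d = 2 ∧ n % 4 = 2 then 2 else 0


/-- The inequality description of the lattice points of `P_{δ_n}`. -/
def IsBreak (n : ℕ) (x : Fin n → ℤ) : Prop :=
  2 * ∑ i, x i = ((n : ℤ) - 1) * ((n : ℤ) - 2) ∧
  ∀ S : Finset (Fin n), S.Nonempty →
    ((S.card : ℤ) - 1) * ((S.card : ℤ) - 2) ≤ 2 * ∑ i ∈ S, x i

theorem two_sum_pred (s : ℕ) (hs : 1 ≤ s) :
    2 * ∑ i ∈ Finset.range s, (((i - 1 : ℕ)) : ℤ) = ((s : ℤ) - 1) * ((s : ℤ) - 2) := by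
  induction s, hs using Nat.le_induction with
  | base => simp
  | succ k hk ih =>
    rw [Finset.sum_range_succ, mul_add, ih]
    push_cast [Nat.cast_sub hk]
    ring

theorem two_sum_tail (n k : ℕ) (hk : k < n) :
    2 * ∑ i ∈ Finset.Ico k n, (((n - 2 - i : ℕ)) : ℤ)
      = (((n - k : ℕ) : ℤ) - 1) * (((n - k : ℕ) : ℤ) - 2) := by
  rw [← two_sum_pred (n - k) (by omega), Finset.sum_Ico_eq_sum_range, ← Finset.sum_range_reflect]
  congr 1
  apply Finset.sum_congr rfl
  intro j hj
  rw [Finset.mem_range] at hj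
  congr 1
  omega

theorem two_sum_lower (T : Finset ℕ) (hT : T.Nonempty) :
    ((T.card : ℤ) - 1) * ((T.card : ℤ) - 2) ≤ 2 * ∑ j ∈ T, (((j - 1 : ℕ)) : ℤ) := by
  induction T using Finset.induction_on_max with
  | empty => simp at hT
  | insert a s ha ih =>
    have hns : a ∉ s := fun h => lt_irrefl _ (ha a h)
    rw [Finset.sum_insert hns, Finset.card_insert_of_notMem hns]
    rcases s.eq_empty_or_nonempty with rfl | hs
    · simp
    · have h1 := ih hs
      have h2 : s.card ≤ a := by
        have : s ⊆ Finset.range a := fun x hx => Finset.mem_range.2 (ha x hx)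
        simpa using Finset.card_le_card this
      have h3 : 1 ≤ s.card := hs.card_pos
      have h4 : ((a - 1 : ℕ) : ℤ) = (a : ℤ) - 1 := by push_cast [Nat.cast_sub (h3.trans h2)]; ring
      rw [h4]
      push_cast
      have h5 : (s.card : ℤ) ≤ a := by exact_mod_cast h2
      nlinarith

theorem delta_lower (n : ℕ) (S : Finset (Fin n)) (hS : S.Nonempty) :
    ((S.card : ℤ) - 1) * ((S.card : ℤ) - 2) ≤ 2 * ∑ i ∈ S, (deltaTuple n i : ℤ) := by
  have hinj : Function.Injective (fun i : Fin n => n - 1 - (i : ℕ)) := by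
    intro i j h
    simp only at h
    ext
    omega
  have := two_sum_lower (S.image (fun i : Fin n => n - 1 - (i : ℕ))) (hS.image _)
  rw [Finset.card_image_of_injective _ hinj, Finset.sum_image (fun _ _ _ _ h => hinj h)] at this
  refine this.trans (le_of_eq ?_)
  congr 1
  apply Finset.sum_congr rfl
  intro i _
  unfold deltaTuple
  congr 1
  omega

theorem delta_tail (n k : ℕ) (hk : k < n) :
    2 * ∑ i : Fin n, (if k ≤ (i : ℕ) then (deltaTuple n i : ℤ) else 0)
      = (((n - k : ℕ) : ℤ) - 1) * (((n - k : ℕ) : ℤ) - 2) := by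
  rw [← two_sum_tail n k hk]
  congr 1
  unfold deltaTuple
  rw [Fin.sum_univ_eq_sum_range (fun i => if k ≤ i then (((n - 2 - i : ℕ)) : ℤ) else 0) n,
    ← Finset.sum_filter]
  apply Finset.sum_congr _ (fun _ _ => rfl)
  ext i
  simp
  omega

theorem card_tail (n k : ℕ) :
    (Finset.univ.filter (fun i : Fin n => k ≤ (i : ℕ))).card = n - k := by
  rw [← Finset.card_map Fin.valEmbedding]
  rw [← Nat.card_Ico]
  congr 1
  ext j
  simp
  constructor
  · rintro ⟨a, h, rfl⟩; exact ⟨h, a.2⟩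
  · rintro ⟨h1, h2⟩; exact ⟨⟨j, h2⟩, h1, rfl⟩

theorem abel_ineq (n : ℕ) : ∀ (W z : Fin n → ℝ) (m : ℝ), Monotone W → (∀ i, m ≤ W i) →
    (∀ k : ℕ, 0 ≤ ∑ i : Fin n, (if k ≤ (i : ℕ) then z i else 0)) →
    m * ∑ i, z i ≤ ∑ i, W i * z i := by
  induction n with
  | zero => intro W z m _ _ _; simp
  | succ n ih =>
    intro W z m hW hm hz
    rw [Fin.sum_univ_succ, Fin.sum_univ_succ (fun i => W i * z i)]
    have h1 := ih (fun i => W i.succ) (fun i => z i.succ) (W 0)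
      (fun i j h => hW (Fin.succ_le_succ_iff.2 h)) (fun i => hW (Fin.zero_le _)) (by
        intro k
        have := hz (k + 1)
        rw [Fin.sum_univ_succ] at this
        simpa using this)
    have h2 := hz 0
    simp only [Nat.zero_le, if_true, Fin.sum_univ_succ] at h2
    have h3 := hm 0
    nlinarith

theorem sum_delta (n : ℕ) (hn : 2 ≤ n) :
    2 * ∑ i : Fin n, (deltaTuple n i : ℤ) = ((n : ℤ) - 1) * ((n : ℤ) - 2) := by
  have := delta_tail n 0 (by omega)
  simpa using this

theorem mem_latticePts_iff (n : ℕ) (hn : 2 ≤ n) (x : Fin n → ℤ) :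
    x ∈ latticePts n ↔ IsBreak n x := by
  constructor
  · intro hx
    have hsub : convexHull ℝ (permutahedronVerts n) ⊆
        {y : Fin n → ℝ | 2 * ∑ i, y i = ((n : ℝ) - 1) * ((n : ℝ) - 2) ∧
          ∀ S : Finset (Fin n), S.Nonempty →
            ((S.card : ℝ) - 1) * ((S.card : ℝ) - 2) ≤ 2 * ∑ i ∈ S, y i} := by
      apply convexHull_min
      · rintro y ⟨τ, rfl⟩
        constructor
        · rw [Equiv.sum_comp τ (fun i => (deltaTuple n i : ℝ))]
          exact_mod_cast sum_delta n hn
        · intro S hS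
          have := delta_lower n (S.map τ.toEmbedding) (by simpa using hS)
          rw [Finset.card_map, Finset.sum_map] at this
          have h2 := (Int.cast_le (R := ℝ)).2 this
          push_cast at h2
          exact h2
      · intro y hy z hz a b ha hb hab
        refine ⟨?_, fun S hS => ?_⟩
        · simp only [Pi.add_apply, Pi.smul_apply, smul_eq_mul, Finset.sum_add_distrib,
            ← Finset.mul_sum]
          have h1 := hy.1
          have h2 := hz.1
          calc 2 * (a * ∑ i, y i + b * ∑ i, z i)
              = a * (2 * ∑ i, y i) + b * (2 * ∑ i, z i) := by ring
            _ = (a + b) * (((n : ℝ) - 1) * ((n : ℝ) - 2)) := by rw [h1, h2]; ring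
            _ = _ := by rw [hab, one_mul]
        · simp only [Pi.add_apply, Pi.smul_apply, smul_eq_mul, Finset.sum_add_distrib,
            ← Finset.mul_sum]
          have h1 := hy.2 S hS
          have h2 := hz.2 S hS
          calc ((S.card : ℝ) - 1) * ((S.card : ℝ) - 2)
              = a * (((S.card : ℝ) - 1) * ((S.card : ℝ) - 2))
                + b * (((S.card : ℝ) - 1) * ((S.card : ℝ) - 2)) := by
                  rw [← add_mul, hab, one_mul]
            _ ≤ a * (2 * ∑ i ∈ S, y i) + b * (2 * ∑ i ∈ S, z i) := by gcongr
            _ = _ := by ring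
    have h := hsub hx
    refine ⟨?_, fun S hS => ?_⟩
    · have h1 := h.1
      rw [← Int.cast_inj (α := ℝ)]
      push_cast
      exact h1
    · have h1 := h.2 S hS
      rw [← Int.cast_le (R := ℝ)]
      push_cast
      exact h1
  · intro hx
    by_contra hcon
    have hfin : (permutahedronVerts n).Finite := by
      have : permutahedronVerts n =
          Set.range (fun (σ : Equiv.Perm (Fin n)) (i : Fin n) => (deltaTuple n (σ i) : ℝ)) := by
        ext y
        simp [permutahedronVerts, eq_comm]
      rw [this]
      exact Set.finite_range _
    obtain ⟨f, u, hu, hv⟩ := geometric_hahn_banach_point_closed (convex_convexHull ℝ _)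
      (hfin.isClosed_convexHull ℝ) hcon
    obtain ⟨w, hw⟩ : ∃ w : Fin n → ℝ, ∀ y, f y = ∑ i, w i * y i := by
      refine ⟨fun i => f (fun j => if i = j then 1 else 0), fun y => ?_⟩
      have := LinearMap.pi_apply_eq_sum_univ (f : (Fin n → ℝ) →ₗ[ℝ] ℝ) y
      simp only [ContinuousLinearMap.coe_coe, smul_eq_mul] at this
      rw [this]
      exact Finset.sum_congr rfl fun _ _ => mul_comm _ _
    set τ := Tuple.sort w with hτ
    have hmono : Monotone (w ∘ τ) := Tuple.monotone_sort w
    have hvert := hv _ (subset_convexHull ℝ _ ⟨τ⁻¹, rfl⟩)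
    have hlt := hu.trans hvert
    rw [hw, hw, ← Equiv.sum_comp τ, ← Equiv.sum_comp τ (fun i => w i * _)] at hlt
    simp only [Equiv.Perm.inv_def, Equiv.symm_apply_apply] at hlt
    have hn0 : 0 < n := by omega
    have key := abel_ineq n (w ∘ τ) (fun i => (x (τ i) : ℝ) - (deltaTuple n i : ℝ))
      (w (τ ⟨0, hn0⟩)) hmono (fun i => hmono (Fin.mk_le_of_le_val (Nat.zero_le _))) (by
        intro k
        rcases lt_or_ge k n with hk | hk
        · have h1 := delta_tail n k hk
          have h2 := hx.2 ((Finset.univ.filter (fun i : Fin n => k ≤ (i : ℕ))).map τ.toEmbedding)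
            (by rw [Finset.map_nonempty, ← Finset.card_pos, card_tail]; omega)
          rw [Finset.card_map, card_tail, Finset.sum_map, ← h1, Finset.sum_filter] at h2
          have h3 : (0 : ℤ) ≤ ∑ i : Fin n, (if k ≤ (i : ℕ) then x (τ i) - deltaTuple n i else 0) := by
            have h4 : ∑ i : Fin n, (if k ≤ (i : ℕ) then x (τ i) - deltaTuple n i else 0)
              = ∑ i : Fin n, (if k ≤ (i : ℕ) then x (τ i) else 0)
                - ∑ i : Fin n, (if k ≤ (i : ℕ) then (deltaTuple n i : ℤ) else 0) := by
              rw [← Finset.sum_sub_distrib]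
              exact Finset.sum_congr rfl fun i _ => by split_ifs <;> simp
            rw [h4]
            simp only [Equiv.coe_toEmbedding] at h2
            linarith
          exact_mod_cast h3
        · apply le_of_eq
          symm
          apply Finset.sum_eq_zero
          intro i _
          rw [if_neg]
          have := i.2
          omega)
    have hz : ∑ i, ((x (τ i) : ℝ) - (deltaTuple n i : ℝ)) = 0 := by
      rw [Finset.sum_sub_distrib, Equiv.sum_comp τ (fun i => (x i : ℝ))]
      have h1 := hx.1
      rw [← sum_delta n hn] at h1
      have h2 : ∑ i, x i = ∑ i, (deltaTuple n i : ℤ) := by linarith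
      rw [sub_eq_zero]
      exact_mod_cast h2
    rw [hz, mul_zero] at key
    simp only [Function.comp_apply, mul_sub, Finset.sum_sub_distrib] at key
    linarith

theorem break_unique (n : ℕ) (x y : Fin n → ℤ) (hx : IsBreak n x) (hy : IsBreak n y)
    (c : ℤ) (hc : ∀ i, (n : ℤ) ∣ x i - y i - c) : x = y := by
  rcases isEmpty_or_nonempty (Fin n) with he | hne
  · exact funext fun i => he.elim i
  choose a ha using hc
  obtain ⟨i0, -, hi0⟩ := Finset.exists_min_image Finset.univ a Finset.univ_nonempty
  have hn0 : (n : ℤ) ≠ 0 := by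
    have := Fin.pos i0
    omega
  obtain ⟨b, hb⟩ : ∃ b : Fin n → ℤ, b = fun i => a i - a i0 := ⟨_, rfl⟩
  obtain ⟨C, hC⟩ : ∃ C : ℤ, C = -(c + n * a i0) := ⟨_, rfl⟩
  have hb0 : ∀ i, 0 ≤ b i := fun i => by
    rw [hb]; exact sub_nonneg.2 (hi0 i (Finset.mem_univ i))
  have hxy : ∀ i, x i - y i = n * b i - C := fun i => by
    have := ha i
    rw [hb, hC]
    simp only
    linarith
  have hsum : C = ∑ i, b i := by
    have h1 : ∑ i, (x i - y i) = 0 := by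
      rw [Finset.sum_sub_distrib]
      linarith [hx.1, hy.1]
    simp only [hxy, Finset.sum_sub_distrib, ← Finset.mul_sum, Finset.sum_const, Finset.card_univ,
      Fintype.card_fin, nsmul_eq_mul] at h1
    rw [← mul_sub] at h1
    rcases mul_eq_zero.1 h1 with h | h
    · exact absurd h hn0
    · linarith
  set S := Finset.univ.filter (fun i => b i = 0) with hS
  have hSne : S.Nonempty := ⟨i0, by simp [hS, hb]⟩
  rcases Sᶜ.eq_empty_or_nonempty with hT | hT
  · have hall : ∀ i, b i = 0 := by
      intro i
      have : i ∈ S := by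
        rw [Finset.compl_eq_empty_iff] at hT
        rw [hT]; exact Finset.mem_univ i
      simpa [hS] using this
    have hC0 : C = 0 := by rw [hsum]; simp [hall]
    funext i
    have := hxy i
    rw [hall, hC0] at this
    linarith
  · exfalso
    have h1 := hx.2 S hSne
    have h2 := hy.2 Sᶜ hT
    have h3 := hy.1
    have h4 : (n : ℤ) = S.card + Sᶜ.card := by
      have := Finset.card_add_card_compl S
      rw [Fintype.card_fin] at this
      exact_mod_cast this.symm
    have h5 : (Sᶜ.card : ℤ) ≤ C := by
      rw [hsum, ← Finset.sum_add_sum_compl S b]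
      have h6 : ∑ i ∈ S, b i = 0 := Finset.sum_eq_zero fun i hi => by simpa [hS] using hi
      have h7 : (Sᶜ.card : ℤ) = ∑ i ∈ Sᶜ, (1 : ℤ) := by simp
      rw [h6, zero_add, h7]
      apply Finset.sum_le_sum
      intro i hi
      have h8 : b i ≠ 0 := by simpa [hS] using hi
      have := hb0 i
      omega
    have h9 : ∑ i ∈ S, x i = ∑ i ∈ S, y i - S.card * C := by
      have h10 : ∑ i ∈ S, (x i - y i) = ∑ i ∈ S, (-C) := by
        apply Finset.sum_congr rfl
        intro i hi
        have h8 : b i = 0 := by simpa [hS] using hi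
        rw [hxy, h8]
        ring
      rw [Finset.sum_sub_distrib, Finset.sum_const, nsmul_eq_mul] at h10
      linarith
    rw [← Finset.sum_add_sum_compl S y, h4] at h3
    have h11 : (S.card : ℤ) * Sᶜ.card ≤ S.card * C :=
      mul_le_mul_of_nonneg_left h5 (by positivity)
    nlinarith

theorem break_exists (n : ℕ) (z : Fin n → ℤ)
    (hz : 2 * ∑ i, z i = ((n : ℤ) - 1) * ((n : ℤ) - 2)) :
    ∃ x, IsBreak n x ∧ ∃ c : ℤ, ∀ i, (n : ℤ) ∣ x i - z i - c := by
  obtain ⟨x, ⟨hx1, c, hc⟩, hmin⟩ :=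
    (measure (fun x : Fin n → ℤ => (∑ i, x i ^ 2).toNat)).wf.has_min
      {x | 2 * ∑ i, x i = ((n : ℤ) - 1) * ((n : ℤ) - 2) ∧
        ∃ c : ℤ, ∀ i, (n : ℤ) ∣ x i - z i - c} ⟨z, hz, 0, fun i => by simp⟩
  refine ⟨x, ⟨hx1, fun S hS => ?_⟩, c, hc⟩
  obtain ⟨s, hs⟩ : ∃ s : ℤ, s = S.card := ⟨_, rfl⟩
  obtain ⟨t, ht⟩ : ∃ t : ℤ, t = Sᶜ.card := ⟨_, rfl⟩
  have hst : (n : ℤ) = s + t := by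
    have := Finset.card_add_card_compl S
    rw [Fintype.card_fin] at this
    rw [hs, ht]
    exact_mod_cast this.symm
  have hs0 : 0 < s := by rw [hs]; exact_mod_cast hS.card_pos
  have ht0 : 0 ≤ t := by rw [ht]; positivity
  obtain ⟨x', hx'⟩ : ∃ x' : Fin n → ℤ, x' = fun i => x i + (if i ∈ S then t else -s) := ⟨_, rfl⟩
  have e1 : ∀ i ∈ S, x' i = x i + t := fun i hi => by rw [hx']; simp [hi]
  have e2 : ∀ i ∈ Sᶜ, x' i = x i - s := fun i hi => by
    rw [hx']; simp [Finset.mem_compl.1 hi, sub_eq_add_neg]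
  have hmem := hmin x' ⟨by
      rw [← hx1, ← Finset.sum_add_sum_compl S x', ← Finset.sum_add_sum_compl S x,
        Finset.sum_congr rfl e1, Finset.sum_congr rfl e2, Finset.sum_add_distrib,
        Finset.sum_sub_distrib, Finset.sum_const, Finset.sum_const, nsmul_eq_mul, nsmul_eq_mul,
        ← hs, ← ht]
      ring, c - s, fun i => by
      by_cases hi : i ∈ S
      · rw [e1 i hi]
        have : x i + t - z i - (c - s) = (x i - z i - c) + n := by rw [hst]; ring
        rw [this]
        exact dvd_add (hc i) dvd_rfl
      · rw [e2 i (Finset.mem_compl.2 hi)]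
        have : x i - s - z i - (c - s) = (x i - z i - c) := by ring
        rw [this]
        exact hc i⟩
  have hle : ∑ i, x i ^ 2 ≤ ∑ i, x' i ^ 2 := by
    have h1 : 0 ≤ ∑ i, x i ^ 2 := Finset.sum_nonneg fun i _ => sq_nonneg _
    have h2 : 0 ≤ ∑ i, x' i ^ 2 := Finset.sum_nonneg fun i _ => sq_nonneg _
    have h3 : ¬ ((∑ i, x' i ^ 2).toNat < (∑ i, x i ^ 2).toNat) := hmem
    omega
  have hS1 : ∑ i ∈ S, x' i ^ 2 = ∑ i ∈ S, x i ^ 2 + 2 * t * ∑ i ∈ S, x i + s * t ^ 2 := by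
    rw [hs, Finset.mul_sum, ← nsmul_eq_mul, ← Finset.sum_const, ← Finset.sum_add_distrib,
      ← Finset.sum_add_distrib]
    exact Finset.sum_congr rfl fun i hi => by rw [e1 i hi]; ring
  have hS2 : ∑ i ∈ Sᶜ, x' i ^ 2 = ∑ i ∈ Sᶜ, x i ^ 2 - 2 * s * ∑ i ∈ Sᶜ, x i + t * s ^ 2 := by
    rw [ht, Finset.mul_sum, ← nsmul_eq_mul, ← Finset.sum_const, ← Finset.sum_sub_distrib,
      ← Finset.sum_add_distrib]
    exact Finset.sum_congr rfl fun i hi => by rw [e2 i hi]; ring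
  rw [← Finset.sum_add_sum_compl S, ← Finset.sum_add_sum_compl S (fun i => x' i ^ 2), hS1, hS2]
    at hle
  rw [← Finset.sum_add_sum_compl S x] at hx1
  rw [← hs]
  generalize ∑ i ∈ S, x i = X at *
  generalize ∑ i ∈ Sᶜ, x i = X' at *
  by_contra hcon
  push Not at hcon
  have heven : Even ((s - 1) * (s - 2)) := by
    have := Int.even_mul_succ_self (s - 2)
    have e : (s - 1) * (s - 2) = (s - 2) * (s - 2 + 1) := by ring
    rwa [e]
  obtain ⟨r, hr⟩ := heven
  have h6 : X + 1 ≤ r := by omega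
  have h7 : 2 * X ≤ s ^ 2 - 3 * s := by nlinarith
  have h8 : (s + t) * (2 * X) ≤ (s + t) * (s ^ 2 - 3 * s) :=
    mul_le_mul_of_nonneg_left h7 (by linarith)
  rw [hst] at hx1
  have h9 : s * (2 * (X + X')) = s * ((s + t - 1) * (s + t - 2)) := by rw [hx1]
  nlinarith

/-- the genus of the complete graph -/
def genusK (n : ℕ) : ℕ := (n - 1) * (n - 2) / 2

theorem two_genusK (n : ℕ) (hn : 2 ≤ n) : 2 * genusK n = (n - 1) * (n - 2) := by
  unfold genusK
  apply Nat.mul_div_cancel'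
  obtain ⟨m, rfl⟩ := Nat.exists_eq_add_of_le hn
  have := Nat.even_mul_succ_self m
  have e : (2 + m - 1) * (2 + m - 2) = m * (m + 1) := by
    rw [show 2 + m - 1 = m + 1 by omega, show 2 + m - 2 = m by omega, mul_comm]
  rw [e]
  exact this.two_dvd

theorem two_genusK_int (n : ℕ) (hn : 2 ≤ n) :
    2 * (genusK n : ℤ) = ((n : ℤ) - 1) * ((n : ℤ) - 2) := by
  have := congrArg (Nat.cast : ℕ → ℤ) (two_genusK n hn)
  push_cast [Nat.cast_sub hn, Nat.cast_sub (show 1 ≤ n by omega)] at this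
  exact this

theorem IsBreak.comp {n : ℕ} {x : Fin n → ℤ} (hx : IsBreak n x) (σ : Equiv.Perm (Fin n)) :
    IsBreak n (x ∘ σ) := by
  refine ⟨?_, fun S hS => ?_⟩
  · rw [← hx.1]
    congr 1
    exact Equiv.sum_comp σ x
  · have := hx.2 (S.map σ.toEmbedding) (by simpa using hS)
    rw [Finset.card_map, Finset.sum_map] at this
    exact this

theorem card_break_mul (n : ℕ) (hn : 2 ≤ n) (σ : Equiv.Perm (Fin n)) :
    Nat.card {x : Fin n → ℤ // IsBreak n x ∧ ∀ i, x (σ i) = x i} * n =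
      Nat.card {y : Fin n → ZMod n // (∀ i, y (σ i) = y i) ∧ ∑ i, y i = (genusK n : ZMod n)} := by
  have : NeZero n := ⟨by omega⟩
  have hsumx : ∀ x, IsBreak n x → ∑ i, x i = (genusK n : ℤ) := fun x hx => by
    have h1 := hx.1
    rw [← two_genusK_int n hn] at h1
    linarith
  trans Nat.card ({x : Fin n → ℤ // IsBreak n x ∧ ∀ i, x (σ i) = x i} × ZMod n)
  · rw [Nat.card_prod, Nat.card_zmod]
  refine Nat.card_congr (Equiv.ofBijective (fun p => ⟨fun i => (p.1.1 i : ZMod n) + p.2,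
    fun i => by simp only [p.1.2.2 i], ?_⟩) ⟨?_, ?_⟩)
  · rw [Finset.sum_add_distrib, ← Int.cast_sum, hsumx _ p.1.2.1]
    simp
  · rintro ⟨⟨x, hx⟩, c⟩ ⟨⟨x', hx'⟩, c'⟩ h
    simp only [Subtype.mk.injEq] at h
    have hxx : x = x' := by
      apply break_unique n x x' hx.1 hx'.1 ((c' - c).val : ℤ)
      intro i
      rw [← ZMod.intCast_zmod_eq_zero_iff_dvd]
      have := congrFun h i
      push_cast
      rw [ZMod.natCast_zmod_val]
      linear_combination this
    subst hxx
    have := congrFun h 0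
    simp only [add_right_inj] at this
    rw [this]
  · rintro ⟨y, hy1, hy2⟩
    obtain ⟨q, hq⟩ : ∃ q : ℤ, (genusK n : ℤ) - ∑ i, ((y i).val : ℤ) = n * q := by
      have : (n : ℤ) ∣ (genusK n : ℤ) - ∑ i, ((y i).val : ℤ) := by
        rw [← ZMod.intCast_zmod_eq_zero_iff_dvd]
        push_cast
        simp [hy2]
      exact this
    obtain ⟨x, hx, c, hc⟩ := break_exists n (fun i => ((y i).val : ℤ) + (if i = 0 then (n : ℤ) * q else 0)) (by
      rw [Finset.sum_add_distrib, Finset.sum_ite_eq', ← two_genusK_int n hn]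
      simp only [Finset.mem_univ, if_true]
      linarith)
    have hxy : ∀ i, (x i : ZMod n) = y i + c := by
      intro i
      have h1 := hc i
      rw [← ZMod.intCast_zmod_eq_zero_iff_dvd] at h1
      have h2 : (((if i = 0 then (n : ℤ) * q else 0) : ℤ) : ZMod n) = 0 := by
        split_ifs <;> simp
      rw [Int.cast_sub, Int.cast_sub, Int.cast_add, h2, Int.cast_natCast, ZMod.natCast_zmod_val] at h1
      linear_combination h1
    have hfix : x ∘ σ = x := by
      apply break_unique n _ _ (hx.comp σ) hx 0
      intro i
      rw [← ZMod.intCast_zmod_eq_zero_iff_dvd]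
      push_cast
      simp only [Function.comp_apply]
      rw [hxy, hxy, hy1]
      ring
    refine ⟨(⟨x, hx, fun i => congrFun hfix i⟩, -(c : ZMod n)), ?_⟩
    apply Subtype.ext
    funext i
    simp only [hxy]
    ring

/-- The set of cycles of `σ`. -/
abbrev CycQ {n : ℕ} (σ : Equiv.Perm (Fin n)) : Type :=
  Quotient (Equiv.Perm.SameCycle.setoid σ)

theorem card_sameCycle {n : ℕ} (σ : Equiv.Perm (Fin n)) (i : Fin n) [DecidableRel σ.SameCycle] :
    (Finset.univ.filter (fun j => σ.SameCycle i j)).card = Function.minimalPeriod σ i := by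
  classical
  have h := MulAction.minimalPeriod_eq_card (a := σ) (b := i)
  have h2 : (fun x => σ • x) = (σ : Fin n → Fin n) := rfl
  rw [h2] at h
  rw [h, ← Set.toFinset_card]
  congr 1
  ext j
  simp only [Finset.mem_filter, Finset.mem_univ, true_and, Set.mem_toFinset,
    MulAction.mem_orbit_iff, Subgroup.exists_zpowers]
  rfl

theorem card_cycQ {n : ℕ} (σ : Equiv.Perm (Fin n)) : Nat.card (CycQ σ) = numCycles σ := by
  classical
  have h1 : numCycles σ = Nat.card (σ.cycleFactorsFinset ⊕ {i // σ i = i}) := by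
    rw [Nat.card_sum]
    unfold numCycles
    rw [Equiv.Perm.cycleType_def, Multiset.card_map]
    congr 1
    · simp
    · rw [Nat.card_eq_fintype_card, Fintype.card_subtype]
  rw [h1]
  let F : Fin n → σ.cycleFactorsFinset ⊕ {i // σ i = i} := fun i =>
    if h : σ i = i then Sum.inr ⟨i, h⟩
    else Sum.inl ⟨σ.cycleOf i, Equiv.Perm.cycleOf_mem_cycleFactorsFinset_iff.2
      (Equiv.Perm.mem_support.2 h)⟩
  have hF : ∀ i j, σ.SameCycle i j ↔ F i = F j := by
    intro i j
    by_cases hi : σ i = i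
    · by_cases hj : σ j = j
      · simp only [F, dif_pos hi, dif_pos hj, Sum.inr.injEq, Subtype.mk.injEq]
        constructor
        · intro h
          exact h.eq_of_left hi
        · rintro rfl; exact Equiv.Perm.SameCycle.refl _ _
      · simp only [F, dif_pos hi, dif_neg hj, reduceCtorEq, iff_false]
        intro h
        exact hj (h.apply_eq_self_iff.1 hi)
    · by_cases hj : σ j = j
      · simp only [F, dif_neg hi, dif_pos hj, reduceCtorEq, iff_false]
        intro h
        exact hi (h.apply_eq_self_iff.2 hj)
      · simp only [F, dif_neg hi, dif_neg hj, Sum.inl.injEq, Subtype.mk.injEq]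
        exact Equiv.Perm.sameCycle_iff_cycleOf_eq_of_mem_support
          (Equiv.Perm.mem_support.2 hi) (Equiv.Perm.mem_support.2 hj)
  refine Nat.card_congr (Equiv.ofBijective
    (Quotient.lift F (fun i j h => (hF i j).1 h)) ⟨?_, ?_⟩)
  · intro a b
    induction a using Quotient.inductionOn with | _ i
    induction b using Quotient.inductionOn with | _ j
    intro h
    exact Quotient.sound ((hF i j).2 h)
  · rintro (⟨c, hc⟩ | ⟨i, hi⟩)
    · obtain ⟨i, hi⟩ := (Equiv.Perm.mem_cycleFactorsFinset_iff.1 hc).1.nonempty_support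
      refine ⟨Quotient.mk _ i, ?_⟩
      have hci := Equiv.Perm.cycle_is_cycleOf hi hc
      have hsi : σ i ≠ i := by
        rw [← Equiv.Perm.mem_support]
        exact Equiv.Perm.mem_cycleFactorsFinset_support_le hc hi
      simp only [Quotient.lift_mk, F, dif_neg hsi, hci]
    · refine ⟨Quotient.mk _ i, ?_⟩
      simp only [Quotient.lift_mk, F, dif_pos hi]

theorem invariant_sameCycle {n : ℕ} {R : Type*} (σ : Equiv.Perm (Fin n)) (y : Fin n → R)
    (hy : ∀ i, y (σ i) = y i) {i j : Fin n} (h : σ.SameCycle i j) : y i = y j := by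
  obtain ⟨k, -, hk⟩ := h.exists_pow_eq'
  rw [← hk]
  clear hk
  induction k with
  | zero => simp
  | succ k ih => rw [pow_succ', Equiv.Perm.mul_apply, hy, ih]

theorem sum_cycQ {n : ℕ} {R : Type*} [CommRing R] (σ : Equiv.Perm (Fin n)) (a : CycQ σ → R) :
    (cycleGcd σ : R) ∣ ∑ i, a (Quotient.mk _ i) := by
  classical
  rw [← Finset.sum_fiberwise Finset.univ (fun i => (Quotient.mk _ i : CycQ σ))]
  apply Finset.dvd_sum
  intro q _
  induction q using Quotient.inductionOn with | _ i
  have h1 : ∀ j ∈ Finset.univ.filter (fun j => (Quotient.mk _ j : CycQ σ) = Quotient.mk _ i),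
      a (Quotient.mk _ j) = a (Quotient.mk _ i) := by
    intro j hj
    rw [(Finset.mem_filter.1 hj).2]
  rw [Finset.sum_congr rfl h1, Finset.sum_const, nsmul_eq_mul]
  apply Dvd.dvd.mul_right
  have h2 : (Finset.univ.filter (fun j => (Quotient.mk _ j : CycQ σ) = Quotient.mk _ i)).card
      = Function.minimalPeriod σ i := by
    rw [← card_sameCycle]
    congr 1
    ext j
    simp only [Finset.mem_filter, Finset.mem_univ, true_and]
    rw [Quotient.eq]
    exact Equiv.Perm.sameCycle_comm
  rw [h2]
  exact Nat.cast_dvd_cast (Finset.gcd_dvd (Finset.mem_univ i))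

theorem cycleGcd_dvd {n : ℕ} (σ : Equiv.Perm (Fin n)) : cycleGcd σ ∣ n := by
  have := sum_cycQ (R := ℤ) σ (fun _ => 1)
  simp at this
  exact_mod_cast this

/-- The sum homomorphism. -/
def sumHom {n : ℕ} (σ : Equiv.Perm (Fin n)) : (CycQ σ → ZMod n) →+ ZMod n where
  toFun a := ∑ i, a (Quotient.mk _ i)
  map_zero' := by simp
  map_add' a b := by simp [Finset.sum_add_distrib]

theorem range_sumHom {n : ℕ} (σ : Equiv.Perm (Fin n)) :
    (sumHom σ).range = AddSubgroup.zmultiples (cycleGcd σ : ZMod n) := by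
  classical
  apply le_antisymm
  · rintro _ ⟨a, rfl⟩
    obtain ⟨r, hr⟩ := sum_cycQ (R := ZMod n) σ a
    obtain ⟨z, rfl⟩ := ZMod.intCast_surjective r
    rw [AddSubgroup.mem_zmultiples_iff]
    refine ⟨z, ?_⟩
    rw [zsmul_eq_mul, mul_comm]
    exact hr.symm
  · rw [AddSubgroup.zmultiples_le]
    obtain ⟨m, hm⟩ := Int.subgroup_cyclic
      ((sumHom σ).range.comap (Int.castAddHom (ZMod n)))
    rw [← AddSubgroup.zmultiples_eq_closure] at hm
    have h1 : ∀ i, m ∣ (Function.minimalPeriod σ i : ℤ) := by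
      intro i
      rw [← Int.mem_zmultiples_iff, ← hm, AddSubgroup.mem_comap]
      refine ⟨fun q => if q = Quotient.mk _ i then 1 else 0, ?_⟩
      simp only [sumHom, AddMonoidHom.coe_mk, ZeroHom.coe_mk, Int.coe_castAddHom, Int.cast_natCast]
      rw [Finset.sum_boole, ← card_sameCycle]
      congr 2
      ext j
      simp only [Finset.mem_filter, Finset.mem_univ, true_and]
      rw [Quotient.eq]
      exact Equiv.Perm.sameCycle_comm
    have h2 : m ∣ (cycleGcd σ : ℤ) := by
      rw [← Int.natAbs_dvd, Int.natCast_dvd_natCast]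
      apply Finset.dvd_gcd
      intro i _
      rw [← Int.natCast_dvd_natCast, Int.natAbs_dvd]
      exact h1 i
    rw [← Int.mem_zmultiples_iff, ← hm, AddSubgroup.mem_comap] at h2
    simpa using h2

theorem card_invariant {n : ℕ} (σ : Equiv.Perm (Fin n)) (g : ZMod n) :
    Nat.card {y : Fin n → ZMod n // (∀ i, y (σ i) = y i) ∧ ∑ i, y i = g} =
      Nat.card (sumHom σ ⁻¹' {g}) := by
  symm
  refine Nat.card_congr (Equiv.ofBijective (fun a => ⟨fun i => a.1 (Quotient.mk _ i),
    fun i => ?_, a.2⟩) ⟨?_, ?_⟩)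
  · have h : σ.SameCycle (σ i) i :=
      Equiv.Perm.sameCycle_apply_left.2 (Equiv.Perm.SameCycle.refl _ _)
    exact congrArg a.1 (Quotient.sound (s := Equiv.Perm.SameCycle.setoid σ) h)
  · rintro ⟨a, ha⟩ ⟨b, hb⟩ h
    simp only [Subtype.mk.injEq] at h
    apply Subtype.ext
    funext q
    induction q using Quotient.inductionOn with | _ i
    exact congrFun h i
  · rintro ⟨y, hy1, hy2⟩
    exact ⟨⟨Quotient.lift y fun i j h => invariant_sameCycle σ y hy1 h, hy2⟩, rfl⟩

theorem card_fiber (n : ℕ) (hn : 2 ≤ n) (σ : Equiv.Perm (Fin n)) (g : ℕ) :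
    n * Nat.card (sumHom σ ⁻¹' {(g : ZMod n)}) =
      if cycleGcd σ ∣ g then cycleGcd σ * n ^ numCycles σ else 0 := by
  have : NeZero n := ⟨by omega⟩
  have hdn := cycleGcd_dvd σ
  have hmem : (g : ZMod n) ∈ (sumHom σ).range ↔ cycleGcd σ ∣ g := by
    rw [range_sumHom, AddSubgroup.mem_zmultiples_iff]
    constructor
    · rintro ⟨z, hz⟩
      have h1 : (n : ℤ) ∣ z * cycleGcd σ - g := by
        rw [← ZMod.intCast_zmod_eq_zero_iff_dvd]
        push_cast
        rw [← hz]
        simp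
      have h2 : (cycleGcd σ : ℤ) ∣ g := by
        have h3 := (Int.natCast_dvd_natCast.2 hdn).trans h1
        exact (dvd_sub_right (Dvd.intro_left _ rfl)).1 h3
      exact_mod_cast h2
    · rintro ⟨k, rfl⟩
      exact ⟨k, by simp [mul_comm]⟩
  split_ifs with h
  · obtain ⟨a, ha⟩ := hmem.2 h
    rw [← ha, Nat.card_congr ((sumHom σ).fiberEquivKer a)]
    have h1 := (sumHom σ).ker.card_mul_index
    rw [AddSubgroup.index_ker, range_sumHom, Nat.card_zmultiples, ZMod.addOrderOf_coe _ (by omega),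
      Nat.gcd_eq_right hdn, Nat.card_fun, Nat.card_zmod, card_cycQ] at h1
    rw [← h1]
    obtain ⟨k, hk⟩ := hdn
    have hd : 0 < cycleGcd σ := by
      rcases Nat.eq_zero_or_pos (cycleGcd σ) with h0 | h0
      · rw [h0, zero_mul] at hk; omega
      · exact h0
    have h2 : n = cycleGcd σ * (n / cycleGcd σ) := (Nat.mul_div_cancel' (cycleGcd_dvd σ)).symm
    calc n * Nat.card (sumHom σ).ker
        = (cycleGcd σ * (n / cycleGcd σ)) * Nat.card (sumHom σ).ker := by rw [← h2]
      _ = _ := by ring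
  · have : IsEmpty (sumHom σ ⁻¹' {(g : ZMod n)}) := ⟨fun a => h (hmem.1 ⟨a.1, a.2⟩)⟩
    simp

theorem fVal_eq (n d : ℕ) (hn : 2 ≤ n) (hd : d ∣ n) :
    (if d ∣ genusK n then d else 0) = fVal n d := by
  have hg := two_genusK_int n hn
  unfold fVal
  by_cases h1 : d = 1
  · simp [h1]
  rw [if_neg h1]
  by_cases h2 : d = 2
  · subst h2
    obtain ⟨k, rfl⟩ := hd
    have e : (genusK (2 * k) : ℤ) = (2 * k - 1) * (k - 1) := by
      push_cast at hg
      linarith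
    have hiff : 2 ∣ genusK (2 * k) ↔ 2 * k % 4 = 2 := by
      have : ((2 : ℕ) : ℤ) ∣ (genusK (2 * k) : ℤ) ↔ 2 * k % 4 = 2 := by
        rw [e]
        have h3 : (2 * (k : ℤ) - 1) * (k - 1) = 2 * (k * (k - 1)) - (k - 1) := by ring
        rw [h3]
        generalize (k : ℤ) * (k - 1) = m
        omega
      rw [← this, Int.natCast_dvd_natCast]
    simp only [hiff, true_and]
  · have hr : ¬ (d = 2 ∧ n % 4 = 2) := fun h => h2 h.1
    rw [if_neg hr, if_neg]
    intro h
    have h3 : (d : ℤ) ∣ 2 := by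
      have h4 : (d : ℤ) ∣ genusK n := Int.natCast_dvd_natCast.2 h
      have h5 : (d : ℤ) ∣ n := Int.natCast_dvd_natCast.2 hd
      have h6 : (2 : ℤ) = 2 * genusK n - n * (n - 3) := by rw [hg]; ring
      rw [h6]
      exact dvd_sub (h4.mul_left _) (h5.mul_right _)
    have h7 : d ∣ 2 := by exact_mod_cast h3
    rcases (Nat.dvd_prime Nat.prime_two).1 h7 with h | h
    · exact h1 h
    · exact h2 h

/-- For a permutation `σ` of `{1,…,n}` with `ℓ` cycles whose lengths have gcd `d`,
`n² · #{lattice points of P_{δ_n} fixed by σ} = f(d) · n^ℓ`. -/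
theorem card_fixed_latticePts (n : ℕ) (hn : 2 ≤ n) (σ : Equiv.Perm (Fin n)) :
    n ^ 2 * Nat.card {x : Fin n → ℤ // x ∈ latticePts n ∧ ∀ i, x (σ i) = x i} =
      fVal n (cycleGcd σ) * n ^ numCycles σ := by
  simp only [mem_latticePts_iff n hn]
  have h1 := card_break_mul n hn σ
  rw [card_invariant] at h1
  have h2 := card_fiber n hn σ (genusK n)
  rw [← h1] at h2
  rw [← fVal_eq n _ hn (cycleGcd_dvd σ), ite_mul, zero_mul, ← h2]
  ring
end
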